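/- arXiv:2305.18659 — 3 statements merged into one kernel-verified Lean document; each statement's English description precedes it below -/
import Mathlib

section
/- Let [λ,Λ] ⊆ (0,∞), ε ∈ (0,1), and p' ∈ ℝ^{n−1} with |p'| ≤ Λ. Let u ∈ C(closure(B₁∩{xₙ>0})) satisfy, in the viscosity sense in B₁∩{xₙ>0}, both M⁺_{λ,Λ}(D²u) + Λ|Du| + Λu₊ + Λ ≥ 0 and M⁻_{λ,Λ}(D²u) − Λ|Du| − Λu₋ − Λ ≤ 0, and suppose −(1/(2ε))|x'|² + p'·x' ≤ u(x',0) ≤ (1/(2ε))|x'|² + p'·x' for all (x',0) ∈ B₁∩{xₙ=0}. Then u(0) = 0 and there exists pₙ ∈ ℝ such that, writing q := (p',pₙ), u is differentiable at the origin with derivative q (i.e. u(x) = q·x + o(|x|) as x → 0 in closure({xₙ>0})), and moreover liminf_{x→0, xₙ>0} [u(x) − (−(1/(2ε))|x'|² + q·x)]/xₙ = 0 and limsup_{x→0, xₙ>0} [u(x) − ((1/(2ε))|x'|² + q·x)]/xₙ = 0. -/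
open Metric Set Filter Topology Bornology

noncomputable section

abbrev Euc (n : ℕ) := EuclideanSpace ℝ (Fin n)

/-- Hessian matrix of a function at a point (second iterated Fréchet derivative,
a purely local notion). -/
def hessianMatrix {n : ℕ} (φ : Euc n → ℝ) (x : Euc n) : Matrix (Fin n) (Fin n) ℝ :=
  Matrix.of fun i j =>
    iteratedFDeriv ℝ 2 φ x ![EuclideanSpace.single i (1 : ℝ), EuclideanSpace.single j (1 : ℝ)]

/-- The set of symmetric matrices `A` with `λ I ≤ A ≤ Λ I`. -/
def pucciSet (n : ℕ) (l L : ℝ) : Set (Matrix (Fin n) (Fin n) ℝ) :=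
  {A | (A - l • (1 : Matrix (Fin n) (Fin n) ℝ)).PosSemidef ∧
       ((L • (1 : Matrix (Fin n) (Fin n) ℝ)) - A).PosSemidef}

/-- Pucci maximal operator `𝓜⁺_{λ,Λ}`. -/
def pucciPlus {n : ℕ} (l L : ℝ) (M : Matrix (Fin n) (Fin n) ℝ) : ℝ :=
  sSup ((fun A : Matrix (Fin n) (Fin n) ℝ => -(A * M).trace) '' pucciSet n l L)

/-- Pucci minimal operator `𝓜⁻_{λ,Λ}`. -/
def pucciMinus {n : ℕ} (l L : ℝ) (M : Matrix (Fin n) (Fin n) ℝ) : ℝ :=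
  sInf ((fun A : Matrix (Fin n) (Fin n) ℝ => -(A * M).trace) '' pucciSet n l L)

/-- `𝓜⁺_{λ,Λ}(D²u) + Λ|Du| + Λu₊ + Λ ≥ 0` in `V` in the viscosity sense. -/
def ViscPucciSuper {n : ℕ} (l L : ℝ) (V : Set (Euc n)) (u : Euc n → ℝ) : Prop :=
  ∀ x₀ : Euc n, ∀ φ : Euc n → ℝ, ∀ r : ℝ,
    0 < r → ball x₀ r ⊆ V → ContDiffOn ℝ 2 φ (ball x₀ r) →
    (∀ x ∈ ball x₀ r, φ x ≤ u x) → u x₀ = φ x₀ →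
    0 ≤ pucciPlus l L (hessianMatrix φ x₀) + L * ‖gradient φ x₀‖ + L * max (u x₀) 0 + L

/-- `𝓜⁻_{λ,Λ}(D²u) − Λ|Du| − Λu₋ − Λ ≤ 0` in `V` in the viscosity sense. -/
def ViscPucciSub {n : ℕ} (l L : ℝ) (V : Set (Euc n)) (u : Euc n → ℝ) : Prop :=
  ∀ x₀ : Euc n, ∀ φ : Euc n → ℝ, ∀ r : ℝ,
    0 < r → ball x₀ r ⊆ V → ContDiffOn ℝ 2 φ (ball x₀ r) →
    (∀ x ∈ ball x₀ r, u x ≤ φ x) → u x₀ = φ x₀ →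
    pucciMinus l L (hessianMatrix φ x₀) - L * ‖gradient φ x₀‖ - L * max (-(u x₀)) 0 - L ≤ 0


/-- One-sided second-order test: whenever a quadratic polynomial with Hessian
`2α e ⊗ e - 2β I` touches `w` from below at a point of `V`, one has `l α ‖e‖² ≤ K β + b ‖p‖ + f`,
where `p` is the gradient of the polynomial at that point. -/
def JetSuper {E : Type*} [NormedAddCommGroup E] [InnerProductSpace ℝ E]
    (l K b f : ℝ) (V : Set E) (w : E → ℝ) : Prop :=
  ∀ x₀ ∈ V, ∀ (p e : E) (α β : ℝ), 0 ≤ α → 0 ≤ β →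
    (∀ᶠ x in 𝓝 x₀, w x₀ + inner ℝ p (x - x₀) + α * inner ℝ e (x - x₀) ^ 2 - β * ‖x - x₀‖ ^ 2
      ≤ w x) →
    l * α * ‖e‖ ^ 2 ≤ K * β + b * ‖p‖ + f

section Jet

variable {E : Type*} [NormedAddCommGroup E] [InnerProductSpace ℝ E]

theorem JetSuper.mono {l K b f : ℝ} {V V' : Set E} {w : E → ℝ}
    (h : JetSuper l K b f V w) (hV : V' ⊆ V) : JetSuper l K b f V' w :=
  fun x₀ hx => h x₀ (hV hx)

theorem JetSuper.sub_of_semiconvex {l K b f κ P : ℝ} {V : Set E} {w g : E → ℝ} (hb : 0 ≤ b)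
    (hκ : 0 ≤ κ) (h : JetSuper l K b f V w)
    (hg : ∀ x₀ ∈ V, ∃ p : E, ‖p‖ ≤ P ∧
      ∀ x, g x₀ + inner ℝ p (x - x₀) - κ * ‖x - x₀‖ ^ 2 ≤ g x) :
    JetSuper l K b (f + K * κ + b * P) V (fun x => w x - g x) := by
  intro x₀ hx p e α β hα hβ ht
  obtain ⟨p', hp', hg'⟩ := hg x₀ hx
  have := h x₀ hx (p + p') e α (β + κ) hα (by positivity) (by
    filter_upwards [ht] with x hx
    have := hg' x
    rw [inner_add_left]
    linarith)
  have h2 : b * ‖p + p'‖ ≤ b * (‖p‖ + P) :=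
    mul_le_mul_of_nonneg_left ((norm_add_le _ _).trans (by gcongr)) hb
  linarith

/-- The test inequality at a minimum of `w - φ`, when `φ` has a second-order lower expansion up to
a cubic error. -/
theorem JetSuper.of_cubic_error {l K b f : ℝ} {V : Set E} {w : E → ℝ} (hK : 0 ≤ K)
    (h : JetSuper l K b f V w) {x₀ : E} (hx : x₀ ∈ V) (p e : E) {α β : ℝ} (C : ℝ)
    (hα : 0 ≤ α) (hβ : 0 ≤ β)
    (ht : ∀ᶠ x in 𝓝 x₀, w x₀ + inner ℝ p (x - x₀) + α * inner ℝ e (x - x₀) ^ 2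
      - β * ‖x - x₀‖ ^ 2 - C * ‖x - x₀‖ ^ 3 ≤ w x) :
    l * α * ‖e‖ ^ 2 ≤ K * β + b * ‖p‖ + f := by
  apply le_of_forall_pos_le_add
  intro δ hδ
  have hc : Tendsto (fun x : E => C * ‖x - x₀‖) (𝓝 x₀) (𝓝 0) := by
    have : Continuous (fun x : E => C * ‖x - x₀‖) := by fun_prop
    simpa using this.tendsto x₀
  have hη : 0 < δ / (K + 1) := by positivity
  have := h x₀ hx p e α (β + δ / (K + 1)) hα (by positivity) (by
    filter_upwards [ht, hc.eventually_lt_const hη] with x h1 h2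
    have : C * ‖x - x₀‖ * ‖x - x₀‖ ^ 2 ≤ δ / (K + 1) * ‖x - x₀‖ ^ 2 := by gcongr
    nlinarith)
  have h3 : K * (δ / (K + 1)) ≤ δ := by
    rw [mul_div_assoc', div_le_iff₀ (by positivity)]
    nlinarith
  linarith

end Jet

section Bridge

variable {n : ℕ}

theorem hasFDerivAt_quadratic (c : ℝ) (p e x₀ : Euc n) (α β : ℝ) (x : Euc n) :
    HasFDerivAt (fun x : Euc n => c + inner ℝ p (x - x₀) + α * inner ℝ e (x - x₀) ^ 2
      - β * ‖x - x₀‖ ^ 2)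
      (innerSL ℝ p + (2 * α * inner ℝ e (x - x₀)) • innerSL ℝ e - (2 * β) • innerSL ℝ (x - x₀))
      x := by
  have h0 : HasFDerivAt (fun x : Euc n => x - x₀) (ContinuousLinearMap.id ℝ (Euc n)) x :=
    (hasFDerivAt_id x).sub_const x₀
  have h1 : ∀ q : Euc n, HasFDerivAt (fun x : Euc n => inner ℝ q (x - x₀)) (innerSL ℝ q) x :=
    fun q => ((innerSL ℝ q).hasFDerivAt.comp x h0)
  have h2 := h0.norm_sq
  refine ((((h1 p).const_add c).add (((h1 e).pow 2).const_mul α)).sub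
    (h2.const_mul β)).congr_fderiv ?_
  ext v
  simp
  ring

theorem hessianMatrix_quadratic (c : ℝ) (p e x₀ : Euc n) (α β : ℝ) :
    hessianMatrix (fun x : Euc n => c + inner ℝ p (x - x₀) + α * inner ℝ e (x - x₀) ^ 2
      - β * ‖x - x₀‖ ^ 2) x₀ =
    (2 * α) • Matrix.vecMulVec e e - (2 * β) • (1 : Matrix (Fin n) (Fin n) ℝ) := by
  have hfd : fderiv ℝ (fun x : Euc n => c + inner ℝ p (x - x₀) + α * inner ℝ e (x - x₀) ^ 2
      - β * ‖x - x₀‖ ^ 2) = fun x => (innerSL ℝ p + (2 * α * inner ℝ e (x - x₀)) • innerSL ℝ e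
        - (2 * β) • innerSL ℝ (x - x₀)) := by
    funext x
    exact (hasFDerivAt_quadratic c p e x₀ α β x).fderiv
  ext i j
  have h0 : HasFDerivAt (fun x : Euc n => x - x₀) (ContinuousLinearMap.id ℝ (Euc n)) x₀ :=
    (hasFDerivAt_id x₀).sub_const x₀
  have h1 : HasFDerivAt (fun x : Euc n => inner ℝ e (x - x₀)) (innerSL ℝ e) x₀ :=
    ((innerSL ℝ e).hasFDerivAt.comp x₀ h0)
  have h2 : HasFDerivAt (fun x : Euc n => innerSL ℝ (x - x₀)) (innerSL ℝ (E := Euc n)) x₀ :=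
    ((innerSL ℝ (E := Euc n)).hasFDerivAt.comp x₀ h0)
  have h3 := ((((h1.const_mul (2 * α)).smul_const (innerSL ℝ e)).const_add (innerSL ℝ p)).sub
    (h2.const_smul (2 * β))).fderiv
  simp only [hessianMatrix, Matrix.of_apply, iteratedFDeriv_two_apply, hfd]
  erw [h3]
  simp [Matrix.vecMulVec_apply, Matrix.one_apply, EuclideanSpace.inner_single_right]
  rw [innerSL_apply_apply, EuclideanSpace.inner_single_left]
  simp only [map_one, one_mul, PiLp.single_apply]
  split_ifs <;> ring

theorem trace_bounds {l L : ℝ} {A : Matrix (Fin n) (Fin n) ℝ} (hA : A ∈ pucciSet n l L)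
    (e : Euc n) {α β : ℝ} (hα : 0 ≤ α) (hβ : 0 ≤ β) :
    2 * (l * α * ‖e‖ ^ 2) - 2 * (L * n * β) ≤
      (A * ((2 * α) • Matrix.vecMulVec e e - (2 * β) • (1 : Matrix (Fin n) (Fin n) ℝ))).trace := by
  obtain ⟨h1, h2⟩ := hA
  have he := h1.dotProduct_mulVec_nonneg (e : Fin n → ℝ)
  have ht := h2.trace_nonneg
  have hn : (e : Fin n → ℝ) ⬝ᵥ (e : Fin n → ℝ) = ‖e‖ ^ 2 := by
    rw [EuclideanSpace.norm_sq_eq]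
    simp [dotProduct, sq]
  have hq : (A * Matrix.vecMulVec (e : Fin n → ℝ) e).trace = (e : Fin n → ℝ) ⬝ᵥ (A.mulVec e) := by
    rw [Matrix.mul_vecMulVec, Matrix.trace_vecMulVec, dotProduct_comm]
  simp only [star_trivial, Matrix.sub_mulVec, Matrix.smul_mulVec, Matrix.one_mulVec,
    dotProduct_sub, dotProduct_smul, smul_eq_mul, hn] at he
  simp only [Matrix.trace_sub, Matrix.trace_smul, Matrix.trace_one, Fintype.card_fin,
    smul_eq_mul] at ht
  simp only [Matrix.mul_sub, Matrix.mul_smul, Matrix.mul_one, Matrix.trace_sub, Matrix.trace_smul,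
    smul_eq_mul, hq]
  nlinarith [mul_le_mul_of_nonneg_left (sub_nonneg.1 he) hα,
    mul_le_mul_of_nonneg_left (sub_nonneg.1 ht) hβ]

theorem smul_one_mem_pucciSet {l L : ℝ} (hl : l ≤ L) :
    l • (1 : Matrix (Fin n) (Fin n) ℝ) ∈ pucciSet n l L := by
  refine ⟨by simpa using Matrix.PosSemidef.zero, ?_⟩
  rw [← sub_smul]
  exact Matrix.PosSemidef.one.smul (sub_nonneg.2 hl)

theorem gradient_quadratic (c : ℝ) (p e x₀ : Euc n) (α β : ℝ) :
    gradient (fun x : Euc n => c + inner ℝ p (x - x₀) + α * inner ℝ e (x - x₀) ^ 2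
      - β * ‖x - x₀‖ ^ 2) x₀ = p := by
  rw [gradient, (hasFDerivAt_quadratic c p e x₀ α β x₀).fderiv,
    LinearIsometryEquiv.symm_apply_eq]
  ext v
  simp

theorem contDiff_quadratic (c : ℝ) (p e x₀ : Euc n) (α β : ℝ) :
    ContDiff ℝ 2 (fun x : Euc n => c + inner ℝ p (x - x₀) + α * inner ℝ e (x - x₀) ^ 2
      - β * ‖x - x₀‖ ^ 2) := by
  have h : ContDiff ℝ 2 (fun x : Euc n => x - x₀) := contDiff_id.sub contDiff_const
  exact ((contDiff_const.add (contDiff_const.inner ℝ h)).add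
    (contDiff_const.mul ((contDiff_const.inner ℝ h).pow 2))).sub
    (contDiff_const.mul (h.norm_sq ℝ))

theorem ViscPucciSuper.jetSuper {l L K₀ : ℝ} (hl : 0 < l) (hL : l ≤ L) {V : Set (Euc n)}
    (hV : IsOpen V) {u : Euc n → ℝ} (hK₀ : 0 ≤ K₀) (hu : ∀ x ∈ V, |u x| ≤ K₀)
    (h : ViscPucciSuper l L V u) :
    JetSuper l (L * n) L (L * K₀ + L) V u := by
  intro x₀ hx p e α β hα hβ ht
  obtain ⟨r, hr, hball⟩ := Metric.eventually_nhds_iff_ball.1 (ht.and (hV.eventually_mem hx))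
  have h1 := h x₀ _ r hr (fun x hx => (hball x hx).2)
    (contDiff_quadratic (u x₀) p e x₀ α β).contDiffOn (fun x hx => (hball x hx).1) (by simp)
  rw [gradient_quadratic, hessianMatrix_quadratic] at h1
  have h2 : pucciPlus l L ((2 * α) • Matrix.vecMulVec (e : Fin n → ℝ) e
      - (2 * β) • (1 : Matrix (Fin n) (Fin n) ℝ)) ≤
      2 * (L * n * β) - 2 * (l * α * ‖e‖ ^ 2) := by
    refine csSup_le (Set.Nonempty.image _ ⟨_, smul_one_mem_pucciSet hL⟩) ?_
    rintro _ ⟨A, hA, rfl⟩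
    have := trace_bounds hA e hα hβ
    dsimp only
    linarith
  have h3 : L * max (u x₀) 0 ≤ L * K₀ :=
    mul_le_mul_of_nonneg_left (max_le ((le_abs_self _).trans (hu x₀ hx)) hK₀) (by linarith)
  have h4 : 0 ≤ L * ‖p‖ := mul_nonneg (by linarith) (norm_nonneg _)
  have h5 : 0 ≤ L * K₀ := mul_nonneg (by linarith) hK₀
  have h6 : 0 ≤ l * α * ‖e‖ ^ 2 := by positivity
  linarith

theorem ViscPucciSub.jetSuper_neg {l L K₀ : ℝ} (hl : 0 < l) (hL : l ≤ L) {V : Set (Euc n)}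
    (hV : IsOpen V) {u : Euc n → ℝ} (hK₀ : 0 ≤ K₀) (hu : ∀ x ∈ V, |u x| ≤ K₀)
    (h : ViscPucciSub l L V u) :
    JetSuper l (L * n) L (L * K₀ + L) V (fun x => -u x) := by
  intro x₀ hx p e α β hα hβ ht
  obtain ⟨r, hr, hball⟩ := Metric.eventually_nhds_iff_ball.1 (ht.and (hV.eventually_mem hx))
  have h1 := h x₀ _ r hr (fun x hx => (hball x hx).2)
    (contDiff_quadratic (u x₀) (-p) e x₀ (-α) (-β)).contDiffOn (fun x hx => by
      have := (hball x hx).1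
      rw [inner_neg_left]
      linarith) (by simp)
  rw [gradient_quadratic, hessianMatrix_quadratic, norm_neg] at h1
  have h2 : 2 * (l * α * ‖e‖ ^ 2) - 2 * (L * n * β) ≤
      pucciMinus l L ((2 * -α) • Matrix.vecMulVec (e : Fin n → ℝ) e
      - (2 * -β) • (1 : Matrix (Fin n) (Fin n) ℝ)) := by
    refine le_csInf (Set.Nonempty.image _ ⟨_, smul_one_mem_pucciSet hL⟩) ?_
    rintro _ ⟨A, hA, rfl⟩
    have := trace_bounds hA e hα hβ
    dsimp only
    have heq : (2 * -α) • Matrix.vecMulVec (e : Fin n → ℝ) e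
        - (2 * -β) • (1 : Matrix (Fin n) (Fin n) ℝ) = -((2 * α) • Matrix.vecMulVec (e : Fin n → ℝ) e
        - (2 * β) • (1 : Matrix (Fin n) (Fin n) ℝ)) := by module
    rwa [heq, Matrix.mul_neg, Matrix.trace_neg, neg_neg]
  have h3 : L * max (-(u x₀)) 0 ≤ L * K₀ :=
    mul_le_mul_of_nonneg_left (max_le ((neg_le_abs _).trans (hu x₀ hx)) hK₀) (by linarith)
  have h4 : 0 ≤ L * ‖p‖ := mul_nonneg (by linarith) (norm_nonneg _)
  have h5 : 0 ≤ L * K₀ := mul_nonneg (by linarith) hK₀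
  have h6 : 0 ≤ l * α * ‖e‖ ^ 2 := by positivity
  linarith

end Bridge

section Barrier

variable {E : Type*} [NormedAddCommGroup E] [InnerProductSpace ℝ E]

theorem exp_neg_cubic_lower {s : ℝ} (hs : |s| ≤ 1) :
    1 - s + s ^ 2 / 2 - |s| ^ 3 ≤ Real.exp (-s) := by
  have h := Real.exp_bound (x := -s) (by rwa [abs_neg]) (n := 3) (by norm_num)
  rw [abs_neg] at h
  norm_num [Finset.sum_range_succ, Nat.factorial] at h
  have h2 := neg_le_of_abs_le h
  have h3 : 0 ≤ |s| ^ 3 := by positivity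
  linarith

/-- Lower cubic expansion of a Gaussian around a point. -/
theorem gaussian_lower_expansion {q : ℝ} (hq : 0 ≤ q) (z x₀ : E) :
    ∃ C : ℝ, ∀ᶠ x in 𝓝 x₀,
      Real.exp (-(q * ‖x₀ - z‖ ^ 2)) * (1 - q * (2 * inner ℝ (x₀ - z) (x - x₀) + ‖x - x₀‖ ^ 2)
        + 2 * q ^ 2 * inner ℝ (x₀ - z) (x - x₀) ^ 2 - C * ‖x - x₀‖ ^ 3)
      ≤ Real.exp (-(q * ‖x - z‖ ^ 2)) := by
  set X := x₀ - z with hX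
  refine ⟨2 * q ^ 2 * ‖X‖ + (q * (2 * ‖X‖ + 1)) ^ 3, ?_⟩
  have hc : Continuous fun x : E => |q * (2 * inner ℝ X (x - x₀) + ‖x - x₀‖ ^ 2)| := by fun_prop
  have hc2 : Continuous fun x : E => ‖x - x₀‖ := by fun_prop
  have e1 := hc.continuousAt.eventually_lt (x₀ := x₀) (continuousAt_const (y := (1 : ℝ))) (by simp)
  have e2 := hc2.continuousAt.eventually_lt (x₀ := x₀) (continuousAt_const (y := (1 : ℝ))) (by simp)
  filter_upwards [e1, e2] with x h1 h2
  set v := x - x₀ with hv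
  set s := q * (2 * inner ℝ X v + ‖v‖ ^ 2) with hs
  have hxz : ‖x - z‖ ^ 2 = ‖X‖ ^ 2 + 2 * inner ℝ X v + ‖v‖ ^ 2 := by
    rw [show x - z = X + v by simp [hX, hv], norm_add_sq_real]
  have hexp : Real.exp (-(q * ‖x - z‖ ^ 2)) = Real.exp (-(q * ‖X‖ ^ 2)) * Real.exp (-s) := by
    rw [← Real.exp_add]
    congr 1
    rw [hxz, hs]
    ring
  rw [hexp]
  refine mul_le_mul_of_nonneg_left (le_trans ?_ (exp_neg_cubic_lower h1.le)) (Real.exp_pos _).le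
  have ht : |inner ℝ X v| ≤ ‖X‖ * ‖v‖ := abs_real_inner_le_norm X v
  have hv0 : 0 ≤ ‖v‖ := norm_nonneg v
  have hX0 : 0 ≤ ‖X‖ := norm_nonneg X
  have hsabs : |s| ≤ q * (2 * ‖X‖ + 1) * ‖v‖ := by
    rw [hs, abs_mul, abs_of_nonneg hq, mul_assoc]
    refine mul_le_mul_of_nonneg_left ?_ hq
    refine (abs_add_le _ _).trans ?_
    rw [abs_mul, abs_of_nonneg (by positivity : 0 ≤ ‖v‖ ^ 2), abs_two]
    nlinarith
  have hs3 : |s| ^ 3 ≤ (q * (2 * ‖X‖ + 1)) ^ 3 * ‖v‖ ^ 3 := by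
    rw [← mul_pow]
    exact pow_le_pow_left₀ (abs_nonneg s) hsabs 3
  have hs2 : 2 * q ^ 2 * inner ℝ X v ^ 2 - 2 * q ^ 2 * ‖X‖ * ‖v‖ ^ 3 ≤ s ^ 2 / 2 := by
    have h5 : -(‖X‖ * ‖v‖) ≤ inner ℝ X v := neg_le_of_abs_le ht
    have h6 : -(‖X‖ * ‖v‖ ^ 3) ≤ inner ℝ X v * ‖v‖ ^ 2 := by
      have := mul_le_mul_of_nonneg_right h5 (by positivity : 0 ≤ ‖v‖ ^ 2)
      linarith
    have h7 : 0 ≤ q ^ 2 * (2 * (inner ℝ X v * ‖v‖ ^ 2 + ‖X‖ * ‖v‖ ^ 3) + ‖v‖ ^ 4 / 2) := by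
      have : 0 ≤ inner ℝ X v * ‖v‖ ^ 2 + ‖X‖ * ‖v‖ ^ 3 := by linarith
      positivity
    rw [hs]
    linarith
  linarith

/-- A nonnegative supersolution that is at least `h` on a small concentric ball is bounded below by
a multiple of `h` times the normalised distance to the boundary. -/
theorem JetSuper.exists_barrier [ProperSpace E] {l K : ℝ} (hl : 0 < l) (hK : 0 ≤ K) :
    ∃ c : ℝ, 0 < c ∧ c ≤ 1 ∧ ∀ (b f R h : ℝ) (z : E) (w : E → ℝ), 0 ≤ b → 0 < R → 0 < h →
      b * R ≤ 1 → f * R ^ 2 ≤ c * h → ContinuousOn w (closedBall z R) →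
      (∀ x ∈ closedBall z R, 0 ≤ w x) → JetSuper l K b f (ball z R) w →
      (∀ x ∈ closedBall z (R / 16), h ≤ w x) →
      ∀ x ∈ closedBall z R, c * h * (1 - ‖x - z‖ / R) ≤ w x := by
  set κ : ℝ := 256 * (K + 3) / l + 1 with hκ
  have hκ1 : 1 ≤ κ := by rw [hκ]; linarith [show 0 ≤ 256 * (K + 3) / l by positivity]
  have hlκ : 256 * (K + 3) < l * κ := by
    have : l * κ = 256 * (K + 3) + l := by rw [hκ]; field_simp
    linarith
  refine ⟨Real.exp (-κ), Real.exp_pos _, Real.exp_le_one_iff.2 (by linarith), ?_⟩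
  intro b f R h z w hb hR hh hbR hfR hwc hw0 hJ hin
  set q : ℝ := κ / R ^ 2 with hq
  have hq0 : 0 < q := by positivity
  have hqR : q * R ^ 2 = κ := by rw [hq]; field_simp
  set ψ : E → ℝ := fun x => h * (Real.exp (-(q * ‖x - z‖ ^ 2)) - Real.exp (-κ)) with hψ
  have hψc : Continuous ψ := by rw [hψ]; fun_prop
  have key : ∀ x ∈ closedBall z R, ψ x ≤ w x := by
    obtain ⟨x₀, hx₀, hmin⟩ := (isCompact_closedBall z R).exists_isMinOn
      ⟨z, mem_closedBall_self hR.le⟩ (hwc.sub hψc.continuousOn)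
    suffices hpos : 0 ≤ w x₀ - ψ x₀ by
      intro x hx
      have := isMinOn_iff.1 hmin x hx
      simp only [Pi.sub_apply] at this
      linarith
    by_contra! hneg
    have hout : R / 16 < ‖x₀ - z‖ := by
      by_contra! hle
      have h1 := hin x₀ (mem_closedBall_iff_norm.2 hle)
      have h2 : Real.exp (-(q * ‖x₀ - z‖ ^ 2)) ≤ 1 := Real.exp_le_one_iff.2 (by
        have : 0 ≤ q * ‖x₀ - z‖ ^ 2 := by positivity
        linarith)
      have h3 : ψ x₀ ≤ h * 1 := mul_le_mul_of_nonneg_left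
        (by linarith [Real.exp_pos (-κ)]) hh.le
      linarith
    have hlt : ‖x₀ - z‖ < R := by
      refine lt_of_le_of_ne (mem_closedBall_iff_norm.1 hx₀) fun heq => ?_
      have h1 := hw0 x₀ hx₀
      have h2 : ψ x₀ = 0 := by simp [hψ, heq, hqR]
      linarith
    have hx₀b : x₀ ∈ ball z R := mem_ball_iff_norm.2 hlt
    set g := Real.exp (-(q * ‖x₀ - z‖ ^ 2)) with hg
    have hg0 : 0 < g := Real.exp_pos _
    obtain ⟨C, hC⟩ := gaussian_lower_expansion hq0.le z x₀
    have hJ' := hJ.of_cubic_error hK hx₀b (-(2 * h * g * q) • (x₀ - z)) (x₀ - z)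
      (α := 2 * h * g * q ^ 2) (β := h * g * q) (h * g * C) (by positivity) (by positivity) (by
        filter_upwards [hC, closedBall_mem_nhds_of_mem hx₀b] with x h1 h2
        have h3 := isMinOn_iff.1 hmin x h2
        simp only [Pi.sub_apply] at h3
        have h4 := mul_le_mul_of_nonneg_left h1 hh.le
        rw [inner_smul_left]
        simp only [hψ, ← hg] at h3
        simp only [conj_trivial]
        linarith)
    have hgκ : Real.exp (-κ) ≤ g := by
      refine Real.exp_le_exp.2 (neg_le_neg ?_)
      rw [← hqR]
      have := pow_le_pow_left₀ (norm_nonneg _) hlt.le 2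
      gcongr
    have hX2 : R ^ 2 / 256 ≤ ‖x₀ - z‖ ^ 2 := by
      have := pow_le_pow_left₀ (by positivity) hout.le 2
      linarith
    rw [norm_smul, norm_neg, Real.norm_of_nonneg (by positivity)] at hJ'
    have h5 : b * (2 * h * g * q * ‖x₀ - z‖) * R ^ 2 ≤ 2 * (h * g * κ) := by
      have h51 : b * ‖x₀ - z‖ ≤ 1 := le_trans (by gcongr) hbR
      have : b * (2 * h * g * q * ‖x₀ - z‖) * R ^ 2 = 2 * (h * g * κ) * (b * ‖x₀ - z‖) := by
        rw [← hqR]; ring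
      rw [this]
      exact mul_le_of_le_one_right (by positivity) h51
    have h6 : l * (2 * h * g * q ^ 2) * ‖x₀ - z‖ ^ 2 * R ^ 2 ≥ (h * g * κ) * (l * κ / 128) := by
      have : (h * g * κ) * (l * κ / 128) = l * (2 * h * g * q ^ 2) * (R ^ 2 / 256) * R ^ 2 := by
        rw [← hqR]; ring
      rw [this]
      gcongr
    have h7 : f * R ^ 2 ≤ h * g * κ := by
      calc f * R ^ 2 ≤ Real.exp (-κ) * h := hfR
        _ ≤ g * h := by gcongr
        _ = h * g * 1 := by ring
        _ ≤ h * g * κ := by gcongr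
    have h8 := mul_le_mul_of_nonneg_right hJ' (by positivity : 0 ≤ R ^ 2)
    have h9 : K * (h * g * q) * R ^ 2 = (h * g * κ) * K := by rw [← hqR]; ring
    have h10 : (h * g * κ) * (l * κ / 128) ≤ (h * g * κ) * (K + 3) := by
      linarith
    have h11 := le_of_mul_le_mul_left h10 (by positivity)
    linarith
  intro x hx
  refine le_trans ?_ (key x hx)
  set τ := ‖x - z‖ / R with hτ
  have hτ0 : 0 ≤ τ := by positivity
  have hτ1 : τ ≤ 1 := (div_le_one hR).2 (mem_closedBall_iff_norm.1 hx)
  have hqτ : q * ‖x - z‖ ^ 2 = κ * τ ^ 2 := by rw [hq, hτ]; field_simp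
  have h1 : Real.exp (-(κ * τ ^ 2)) = Real.exp (-κ) * Real.exp (κ * (1 - τ ^ 2)) := by
    rw [← Real.exp_add]; congr 1; ring
  have h2 : 1 - τ ≤ κ * (1 - τ ^ 2) := by nlinarith [mul_nonneg hτ0 (sub_nonneg.2 hτ1)]
  have h3 := Real.add_one_le_exp (κ * (1 - τ ^ 2))
  simp only [hψ]
  rw [hqτ, h1]
  have h4 : Real.exp (-κ) * (1 - τ) ≤ Real.exp (-κ) * (Real.exp (κ * (1 - τ ^ 2)) - 1) :=
    mul_le_mul_of_nonneg_left (by linarith) (Real.exp_pos _).le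
  nlinarith [mul_le_mul_of_nonneg_left h4 hh.le]

end Barrier

section Contact

variable {E : Type*} [NormedAddCommGroup E] [InnerProductSpace ℝ E]

/-- If two paraboloids of opening `a` touch a supersolution from below at nearby points, then their
vertices are at comparable distance. -/
theorem JetSuper.norm_vertex_sub_le [ProperSpace E] {l K b f ρ a s : ℝ} {c : E} {w : E → ℝ}
    (hl : 0 < l) (hlK : l ≤ K) (hb : 0 ≤ b) (ha : 0 < a) (hbρ : b * ρ ≤ 1)
    (hfa : f ≤ a) (hwc : ContinuousOn w (closedBall c ρ)) (hJ : JetSuper l K b f (ball c ρ) w)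
    {x₀ y₀ x₁ y₁ : E} (hx₀ : ‖x₀ - c‖ ≤ 3 / 4 * ρ) (hxy : ‖x₀ - y₀‖ ≤ ρ)
    (hx₁ : x₁ ∈ closedBall c ρ)
    (h₀ : ∀ x ∈ closedBall c ρ, w x₀ + a * ‖x₀ - y₀‖ ^ 2 ≤ w x + a * ‖x - y₀‖ ^ 2)
    (h₁ : ∀ x ∈ closedBall c ρ, w x₁ + a * ‖x₁ - y₁‖ ^ 2 ≤ w x + a * ‖x - y₁‖ ^ 2)
    (hs : 0 < s) (hxs : ‖x₁ - x₀‖ ≤ s) (hsρ : 32 * K / l * s ≤ ρ / 4)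
    (hsl : 24 * (32 * K / l * s) ≤ ρ * l) :
    ‖y₁ - y₀‖ ≤ 4 * (32 * K / l) ^ 2 * (K + 5) / l * s := by
  have hK : 0 < K := hl.trans_le hlK
  set N := 32 * K / l with hN
  have hN32 : 32 ≤ N := by rw [hN, le_div_iff₀ hl]; linarith
  set A := l / (4 * K) with hA
  have hA0 : 0 < A := by positivity
  have hA1 : A ≤ 1 := by rw [hA, div_le_one (by positivity)]; linarith
  have hAN : A * N = 8 := by rw [hA, hN]; field_simp; norm_num
  have hKA : K * A = l / 4 := by rw [hA]; field_simp
  rcases (norm_nonneg (y₁ - y₀)).eq_or_lt with hk | hk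
  · rw [← hk]; positivity
  set k := ‖y₁ - y₀‖ with hkdef
  set e := k⁻¹ • (y₁ - y₀) with he
  have hen : ‖e‖ = 1 := by
    rw [he, norm_smul, norm_inv, Real.norm_of_nonneg hk.le, ← hkdef, inv_mul_cancel₀ hk.ne']
  have hke : y₁ - y₀ = k • e := by rw [he, smul_smul, mul_inv_cancel₀ hk.ne', one_smul]
  clear_value e
  set η := a * k / (2 * N ^ 2 * s) with hη
  have hη0 : 0 < η := by positivity
  have hηk : 4 * η * N ^ 2 * s ^ 2 = 2 * a * k * s := by rw [hη]; field_simp; norm_num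
  -- the gap between `w` and the first paraboloid
  set g : E → ℝ := fun x => w x + a * ‖x - y₀‖ ^ 2 - (w x₀ + a * ‖x₀ - y₀‖ ^ 2) with hg
  have hg0 : ∀ x ∈ closedBall c ρ, 0 ≤ g x := fun x hx => by
    have := h₀ x hx
    simp only [hg]; linarith
  have hg1 : ∀ x ∈ closedBall c ρ, 2 * a * k * (inner ℝ e (x - x₀) - s) ≤ g x := fun x hx => by
    have h2 := h₁ x hx
    have h3 := h₀ x₁ hx₁
    have h4 : inner ℝ e (x₁ - x₀) ≤ s :=
      (real_inner_le_norm _ _).trans (by rw [hen, one_mul]; exact hxs)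
    have h5 : ∀ y : E, ‖y - y₁‖ ^ 2 = ‖y - y₀‖ ^ 2 - 2 * (k * inner ℝ e (y - y₀)) + k ^ 2 := by
      intro y
      rw [show y - y₁ = (y - y₀) - k • e by rw [← hke]; abel, norm_sub_sq_real, inner_smul_right,
        real_inner_comm, norm_smul, hen, mul_one, Real.norm_of_nonneg hk.le]
    rw [h5, h5] at h2
    have h6 : inner ℝ e (x - y₀) - inner ℝ e (x₁ - y₀) = inner ℝ e (x - x₀) - inner ℝ e (x₁ - x₀) := by
      rw [← inner_sub_right, ← inner_sub_right]; congr 1; abel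
    have h7 : 2 * a * k * (inner ℝ e (x - x₀) - s) ≤
        2 * a * k * (inner ℝ e (x - y₀) - inner ℝ e (x₁ - y₀)) := by
      rw [h6]; gcongr
    simp only [hg]
    linarith
  set φ : E → ℝ := fun x =>
    η * ((inner ℝ e (x - x₀) + N * s) ^ 2 - N ^ 2 * s ^ 2 - A * ‖x - x₀‖ ^ 2) with hφ
  have hφc : Continuous φ := by rw [hφ]; fun_prop
  have hsub : closedBall x₀ (N * s) ⊆ closedBall c ρ := by
    refine closedBall_subset_closedBall' ?_
    rw [dist_eq_norm]; linarith
  have hgc : ContinuousOn g (closedBall x₀ (N * s)) := by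
    refine ((hwc.mono hsub).add ?_).sub continuousOn_const
    exact Continuous.continuousOn (by fun_prop)
  have hNs : 0 < N * s := by positivity
  have hsphere : ∀ x, ‖x - x₀‖ = N * s → φ x ≤ g x := by
    intro x hx
    have hxb : x ∈ closedBall c ρ := hsub (mem_closedBall_iff_norm.2 hx.le)
    have ht : |inner ℝ e (x - x₀)| ≤ N * s := by
      have := abs_real_inner_le_norm e (x - x₀)
      rwa [hen, one_mul, hx] at this
    obtain ⟨ht1, ht2⟩ := abs_le.1 ht
    set t := inner ℝ e (x - x₀) with htdef
    rcases le_total t (2 * s) with hts | hts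
    · refine le_trans ?_ (hg0 x hxb)
      have h1 : (t + N * s) ^ 2 ≤ (2 * s + N * s) ^ 2 := pow_le_pow_left₀ (by linarith) (by linarith) 2
      have h2 : A * (N * s) ^ 2 = 8 * N * s ^ 2 := by rw [← hAN]; ring
      have h3 : (t + N * s) ^ 2 - N ^ 2 * s ^ 2 - A * ‖x - x₀‖ ^ 2 ≤ 0 := by
        rw [hx, h2]
        nlinarith [sq_nonneg s]
      exact mul_nonpos_of_nonneg_of_nonpos hη0.le h3
    · refine le_trans ?_ (hg1 x hxb)
      have h1 : (t + N * s) ^ 2 ≤ (N * s + N * s) ^ 2 := pow_le_pow_left₀ (by linarith) (by linarith) 2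
      have h2 : (t + N * s) ^ 2 - N ^ 2 * s ^ 2 - A * ‖x - x₀‖ ^ 2 ≤ 4 * N ^ 2 * s ^ 2 := by
        have : 0 ≤ A * ‖x - x₀‖ ^ 2 := by positivity
        nlinarith [sq_nonneg (N * s)]
      calc φ x ≤ η * (4 * N ^ 2 * s ^ 2) := mul_le_mul_of_nonneg_left h2 hη0.le
        _ = 2 * a * k * s := by rw [← hηk]; ring
        _ ≤ 2 * a * k * (t - s) := by gcongr; linarith
  obtain ⟨x', hx', hlt, hmin⟩ : ∃ x' ∈ closedBall x₀ (N * s), ‖x' - x₀‖ < N * s ∧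
      ∀ x ∈ closedBall x₀ (N * s), g x' - φ x' ≤ g x - φ x := by
    obtain ⟨x', hx', hmin⟩ := (isCompact_closedBall x₀ (N * s)).exists_isMinOn
      ⟨x₀, mem_closedBall_self hNs.le⟩ (hgc.sub hφc.continuousOn)
    have hmin' := isMinOn_iff.1 hmin
    simp only [Pi.sub_apply] at hmin'
    rcases (mem_closedBall_iff_norm.1 hx').lt_or_eq with hlt | heq
    · exact ⟨x', hx', hlt, hmin'⟩
    · refine ⟨x₀, mem_closedBall_self hNs.le, by simpa using hNs, fun x hx => ?_⟩
      have h1 := hmin' x hx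
      have h2 := hsphere x' heq
      have h3 : g x₀ - φ x₀ = 0 := by simp [hg, hφ, mul_pow]
      linarith
  have hx'b : x' ∈ ball c ρ := by
    rw [mem_ball_iff_norm]
    calc ‖x' - c‖ = ‖(x' - x₀) + (x₀ - c)‖ := by congr 1; abel
      _ ≤ ‖x' - x₀‖ + ‖x₀ - c‖ := norm_add_le _ _
      _ < ρ := by linarith
  set t' := inner ℝ e (x' - x₀) with ht'
  have ht'abs : |t'| ≤ N * s := by
    have := abs_real_inner_le_norm e (x' - x₀)
    rw [hen, one_mul] at this
    exact this.trans hlt.le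
  have hJ' := hJ x' hx'b
    ((-(2 * a)) • (x' - y₀) + (2 * η * (t' + N * s)) • e - (2 * η * A) • (x' - x₀)) e η
    (a + η * A) hη0.le (by positivity) (by
      filter_upwards [closedBall_mem_nhds_of_mem (mem_ball_iff_norm.2 hlt)] with x hx
      have h1 := hmin x hx
      have h2 : ∀ y : E, ‖x - y‖ ^ 2 =
          ‖x' - y‖ ^ 2 + 2 * inner ℝ (x' - y) (x - x') + ‖x - x'‖ ^ 2 := by
        intro y
        rw [show x - y = (x' - y) + (x - x') by abel, norm_add_sq_real]
      have h3 : inner ℝ e (x - x₀) = t' + inner ℝ e (x - x') := by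
        rw [ht', ← inner_add_right]; congr 1; abel
      simp only [hg, hφ, h2 y₀, h2 x₀, h3] at h1
      rw [← ht'] at h1
      simp only [inner_add_left, inner_sub_left, inner_smul_left, conj_trivial] at h1 ⊢
      linarith)
  rw [hen] at hJ'
  have hp : ‖(-(2 * a)) • (x' - y₀) + (2 * η * (t' + N * s)) • e - (2 * η * A) • (x' - x₀)‖ ≤
      2 * a * (2 * ρ) + 6 * η * (N * s) := by
    have n1 : ‖x' - y₀‖ ≤ 2 * ρ := by
      calc ‖x' - y₀‖ = ‖(x' - x₀) + (x₀ - y₀)‖ := by congr 1; abel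
        _ ≤ ‖x' - x₀‖ + ‖x₀ - y₀‖ := norm_add_le _ _
        _ ≤ 2 * ρ := by linarith
    have n2 : |t' + N * s| ≤ 2 * (N * s) := by
      obtain ⟨q1, q2⟩ := abs_le.1 ht'abs
      rw [abs_le]; constructor <;> linarith
    refine (norm_sub_le _ _).trans ?_
    refine (add_le_add_left (norm_add_le _ _) _).trans ?_
    rw [norm_smul, norm_smul, norm_smul, hen, norm_neg, Real.norm_of_nonneg (by positivity),
      Real.norm_eq_abs (2 * η * _), abs_mul, abs_of_nonneg (by positivity : 0 ≤ 2 * η),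
      Real.norm_of_nonneg (by positivity), mul_one]
    have m1 : 2 * a * ‖x' - y₀‖ ≤ 2 * a * (2 * ρ) := by gcongr
    have m2 : 2 * η * |t' + N * s| ≤ 2 * η * (2 * (N * s)) := by gcongr
    have m3 : 2 * η * A * ‖x' - x₀‖ ≤ 2 * η * 1 * (N * s) := by gcongr
    linarith
  have hbp := mul_le_mul_of_nonneg_left hp hb
  have hb1 : b * (2 * a * (2 * ρ)) ≤ 4 * a := by
    calc b * (2 * a * (2 * ρ)) = 4 * a * (b * ρ) := by ring
      _ ≤ 4 * a * 1 := by gcongr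
      _ = 4 * a := mul_one _
  have hb2 : b * (6 * η * (N * s)) ≤ l / 4 * η := by
    calc b * (6 * η * (N * s)) = η / 4 * (b * (24 * (N * s))) := by ring
      _ ≤ η / 4 * (b * (ρ * l)) := by gcongr
      _ = η / 4 * l * (b * ρ) := by ring
      _ ≤ η / 4 * l * 1 := by gcongr
      _ = l / 4 * η := by ring
  have hKη : K * (a + η * A) = K * a + l / 4 * η := by rw [← hKA]; ring
  have hfin : l * η / 2 ≤ a * (K + 5) := by linarith
  have h2 : η * l ≤ 2 * (a * (K + 5)) := by linarith
  have h3 : k = 2 * N ^ 2 * s * η / a := by rw [hη]; field_simp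
  rw [h3, div_le_iff₀ ha, div_mul_eq_mul_div, div_mul_eq_mul_div, le_div_iff₀ hl]
  calc 2 * N ^ 2 * s * η * l = 2 * N ^ 2 * s * (η * l) := by ring
    _ ≤ 2 * N ^ 2 * s * (2 * (a * (K + 5))) := by gcongr
    _ = 4 * N ^ 2 * (K + 5) * s * a := by ring

end Contact

section Growth

open MeasureTheory

variable {E : Type*} [NormedAddCommGroup E] [InnerProductSpace ℝ E] [FiniteDimensional ℝ E]
  [MeasurableSpace E] [BorelSpace E]

theorem hausdorffMeasure_closedBall_mul (z z' : E) {t r : ℝ} (ht : 0 < t) :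
    μH[Module.finrank ℝ E] (closedBall z (t * r)) =
      ENNReal.ofReal (t ^ Module.finrank ℝ E) * μH[Module.finrank ℝ E] (closedBall z' r) := by
  rw [Measure.addHaar_closedBall_mul_of_pos _ _ ht, Measure.addHaar_closedBall_center _ z']

theorem JetSuper.exists_measure_sublevel_center {l K : ℝ} (hl : 0 < l) (hlK : l ≤ K) :
    ∃ M : ENNReal, M ≠ ⊤ ∧ ∀ (b f ρ h : ℝ) (c : E) (w : E → ℝ), 0 ≤ b → 0 < ρ → 0 < h →
      b * ρ ≤ 1 → f * ρ ^ 2 ≤ h → ContinuousOn w (closedBall c ρ) →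
      (∀ x ∈ closedBall c ρ, 0 ≤ w x) → JetSuper l K b f (ball c ρ) w → w c ≤ h / 8 →
      μH[Module.finrank ℝ E] (closedBall c ρ) ≤
        M * μH[Module.finrank ℝ E] {x ∈ closedBall c ρ | w x < h} := by
  have hK : 0 < K := hl.trans_le hlK
  set N := 32 * K / l with hN
  have hN0 : 0 < N := by positivity
  set C := 4 * N ^ 2 * (K + 5) / l with hC
  have hC0 : 0 < C := by positivity
  set c₁ := min (1 / (4 * N)) (l / (24 * N)) with hc₁
  have hc₁0 : 0 < c₁ := by positivity
  set L : ℝ := max C (1 / c₁) with hL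
  have hL0 : 0 ≤ L := hC0.le.trans (le_max_left _ _)
  refine ⟨ENNReal.ofReal (4 ^ Module.finrank ℝ E) * (L.toNNReal : ENNReal) ^
    (Module.finrank ℝ E : ℝ), ENNReal.mul_ne_top ENNReal.ofReal_ne_top
    (ENNReal.rpow_ne_top_of_nonneg (by positivity) ENNReal.coe_ne_top), ?_⟩
  intro b f ρ h c w hb hρ hh hbρ hfρ hwc hw0 hJ hwcen
  set a := h / ρ ^ 2 with ha
  have ha0 : 0 < a := by positivity
  have haρ : a * ρ ^ 2 = h := by rw [ha]; field_simp
  have hfa : f ≤ a := by rwa [ha, le_div_iff₀ (by positivity)]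
  have hcc : c ∈ closedBall c ρ := mem_closedBall_self hρ.le
  have hex : ∀ y : E, ∃ x ∈ closedBall c ρ, ∀ x' ∈ closedBall c ρ,
      w x + a * ‖x - y‖ ^ 2 ≤ w x' + a * ‖x' - y‖ ^ 2 := fun y => by
    obtain ⟨x, hx, hm⟩ := (isCompact_closedBall c ρ).exists_isMinOn ⟨c, hcc⟩
      (hwc.add (Continuous.continuousOn (by fun_prop : Continuous fun x => a * ‖x - y‖ ^ 2)))
    exact ⟨x, hx, isMinOn_iff.1 hm⟩
  choose X hXb hXmin using hex
  have hcon : ∀ y ∈ closedBall c (ρ / 4), w (X y) < h ∧ ‖X y - y‖ ≤ ρ / 2 := by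
    intro y hy
    have h1 := hXmin y c hcc
    have h2 : a * ‖c - y‖ ^ 2 ≤ a * (ρ / 4) ^ 2 := by
      have := mem_closedBall_iff_norm'.1 hy
      gcongr
    have h3 := hw0 _ (hXb y)
    have h4 : 0 ≤ a * ‖X y - y‖ ^ 2 := by positivity
    refine ⟨by linarith, ?_⟩
    have h5 : a * ‖X y - y‖ ^ 2 ≤ a * (ρ / 2) ^ 2 := by linarith
    exact le_of_sq_le_sq (le_of_mul_le_mul_left h5 ha0) (by positivity)
  have hanti : ∀ y₀ ∈ closedBall c (ρ / 4), ∀ y₁ ∈ closedBall c (ρ / 4),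
      ‖y₁ - y₀‖ ≤ L * ‖X y₁ - X y₀‖ := by
    intro y₀ hy₀ y₁ hy₁
    rcases le_total ‖X y₁ - X y₀‖ (c₁ * ρ) with hle | hle
    · suffices hs : ‖y₁ - y₀‖ ≤ C * ‖X y₁ - X y₀‖ from
        hs.trans (mul_le_mul_of_nonneg_right (le_max_left _ _) (norm_nonneg _))
      apply le_of_forall_pos_le_add
      intro δ hδ
      set s := min (c₁ * ρ) (‖X y₁ - X y₀‖ + δ / C) with hs
      have hs0 : 0 < s := lt_min (by positivity) (by positivity)
      have hds : ‖X y₁ - X y₀‖ ≤ s := le_min hle (by linarith [show 0 ≤ δ / C by positivity])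
      have hsc : s ≤ c₁ * ρ := min_le_left _ _
      have h1 : N * s ≤ ρ / 4 := by
        calc N * s ≤ N * (c₁ * ρ) := by gcongr
          _ ≤ N * (1 / (4 * N) * ρ) := by gcongr; exact min_le_left _ _
          _ = ρ / 4 := by field_simp
      have h2 : 24 * (N * s) ≤ ρ * l := by
        calc 24 * (N * s) ≤ 24 * (N * (c₁ * ρ)) := by gcongr
          _ ≤ 24 * (N * (l / (24 * N) * ρ)) := by gcongr; exact min_le_right _ _
          _ = ρ * l := by field_simp
      have h3 : ‖X y₀ - c‖ ≤ 3 / 4 * ρ := by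
        have h31 := (hcon y₀ hy₀).2
        have h32 := mem_closedBall_iff_norm.1 hy₀
        have h33 := norm_add_le (X y₀ - y₀) (y₀ - c)
        rw [sub_add_sub_cancel] at h33
        linarith
      have h4 := hJ.norm_vertex_sub_le hl hlK hb ha0 hbρ hfa hwc h3
        (by linarith [(hcon y₀ hy₀).2]) (hXb y₁) (hXmin y₀) (hXmin y₁) hs0 hds h1 h2
      calc ‖y₁ - y₀‖ ≤ C * s := h4
        _ ≤ C * (‖X y₁ - X y₀‖ + δ / C) := by gcongr; exact min_le_right _ _
        _ = C * ‖X y₁ - X y₀‖ + δ := by field_simp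
    · have h1 : ‖y₁ - y₀‖ ≤ ρ := by
        have h31 := mem_closedBall_iff_norm.1 hy₁
        have h32 := mem_closedBall_iff_norm'.1 hy₀
        have h33 := norm_add_le (y₁ - c) (c - y₀)
        rw [sub_add_sub_cancel] at h33
        linarith
      calc ‖y₁ - y₀‖ ≤ ρ := h1
        _ = 1 / c₁ * (c₁ * ρ) := by field_simp
        _ ≤ L * ‖X y₁ - X y₀‖ := by
          gcongr
          exact le_max_right _ _
  have hA : AntilipschitzWith L.toNNReal (fun y : closedBall c (ρ / 4) => X y) := by
    refine AntilipschitzWith.of_le_mul_dist fun y₁ y₀ => ?_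
    rw [Real.coe_toNNReal _ hL0, Subtype.dist_eq, dist_eq_norm, dist_eq_norm]
    exact hanti _ y₀.2 _ y₁.2
  have h1 := hA.le_hausdorffMeasure_image (d := Module.finrank ℝ E) (by positivity) univ
  have h2 : μH[Module.finrank ℝ E] (univ : Set (closedBall c (ρ / 4))) =
      μH[Module.finrank ℝ E] (closedBall c (ρ / 4)) := by
    rw [← isometry_subtype_coe.hausdorffMeasure_image (Or.inl (by positivity)), image_univ,
      Subtype.range_coe]
  rw [h2] at h1
  have h3 : closedBall c ρ = closedBall c (4 * (ρ / 4)) := by congr 1; ring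
  calc μH[Module.finrank ℝ E] (closedBall c ρ)
      = ENNReal.ofReal (4 ^ Module.finrank ℝ E) *
          μH[Module.finrank ℝ E] (closedBall c (ρ / 4)) := by
        rw [h3, hausdorffMeasure_closedBall_mul c c (by norm_num)]
    _ ≤ _ := by
        rw [mul_assoc]
        gcongr
        refine h1.trans ?_
        gcongr
        rintro _ ⟨y, -, rfl⟩
        exact ⟨hXb y, (hcon y y.2).1⟩

/-- A supersolution that is small at some point of the half ball is small on a set of positive
density. -/
theorem JetSuper.exists_measure_sublevel {l K : ℝ} (hl : 0 < l) (hlK : l ≤ K) :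
    ∃ M : ENNReal, M ≠ ⊤ ∧ ∀ (b f r h : ℝ) (z : E) (w : E → ℝ), 0 ≤ b → 0 ≤ f → 0 < r → 0 < h →
      b * r ≤ 1 → f * r ^ 2 ≤ h → ContinuousOn w (closedBall z r) →
      (∀ x ∈ closedBall z r, 0 ≤ w x) → JetSuper l K b f (ball z r) w →
      ∀ c ∈ closedBall z (r / 2), w c ≤ h / 8 →
      μH[Module.finrank ℝ E] (closedBall z r) ≤
        M * μH[Module.finrank ℝ E] {x ∈ closedBall z r | w x < h} := by
  obtain ⟨M, hM, hmain⟩ := JetSuper.exists_measure_sublevel_center (E := E) hl hlK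
  refine ⟨ENNReal.ofReal (2 ^ Module.finrank ℝ E) * M,
    ENNReal.mul_ne_top ENNReal.ofReal_ne_top hM, ?_⟩
  intro b f r h z w hb hf hr hh hbr hfr hwc hw0 hJ c hc hwcen
  have hsub : closedBall c (r / 2) ⊆ closedBall z r :=
    closedBall_subset_closedBall' (by linarith [mem_closedBall.1 hc])
  have hsub' : ball c (r / 2) ⊆ ball z r := ball_subset_ball' (by linarith [mem_closedBall.1 hc])
  have h1 := hmain b f (r / 2) h c w hb (by positivity) hh
    (le_trans (by gcongr; linarith) hbr) (le_trans (by gcongr; linarith) hfr) (hwc.mono hsub)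
    (fun x hx => hw0 x (hsub hx)) (hJ.mono hsub') hwcen
  have h3 : closedBall z r = closedBall z (2 * (r / 2)) := by congr 1; ring
  calc μH[Module.finrank ℝ E] (closedBall z r)
      = ENNReal.ofReal (2 ^ Module.finrank ℝ E) *
          μH[Module.finrank ℝ E] (closedBall c (r / 2)) := by
        rw [h3, hausdorffMeasure_closedBall_mul z c (by norm_num)]
    _ ≤ _ := by
        rw [mul_assoc]
        gcongr
        refine h1.trans ?_
        gcongr

end Growth

section InkSpots

open MeasureTheory

variable {E : Type*} [NormedAddCommGroup E] [InnerProductSpace ℝ E] [FiniteDimensional ℝ E]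
  [MeasurableSpace E] [BorelSpace E]

/-- A covering argument: if every ball in `closedBall z r` in which `A` has high density is
contained, together with its neighbourhood, in `A'`, then `A' \ A` is large unless `A'`
is everything. -/
theorem measure_le_measure_diff_of_dense_balls (μ : Measure E) [μ.IsAddHaarMeasure] {M : ENNReal}
    (hM : M ≠ ⊤) {z : E} {r : ℝ} (hr : 0 < r) {A A' : Set E} (hA : MeasurableSet A)
    (hAr : A ⊆ closedBall z r)
    (hd : ∀ y s, 0 < s → closedBall y s ⊆ closedBall z r → ‖y - z‖ + s ≤ r →
      μ (closedBall y s) ≤ M * μ (closedBall y s \ A) ∨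
        closedBall y (3 * s) ∩ closedBall z r ⊆ A') :
    closedBall z r ⊆ A' ∨
      μ A ≤ ENNReal.ofReal (5 ^ Module.finrank ℝ E) * M * μ (A' \ A) := by
  refine or_iff_not_imp_left.2 fun hfull => ?_
  set t : Set (E × ℝ) := {q | 0 < q.2 ∧ q.2 ≤ r ∧ closedBall q.1 q.2 ⊆ A' ∧
    μ (closedBall q.1 q.2) ≤ M * μ (closedBall q.1 q.2 \ A)} with ht
  have hcov : ∀ᵐ x ∂μ, x ∈ A → ∃ q ∈ t, x ∈ closedBall q.1 q.2 := by
    have hdens := (IsUnifLocDoublingMeasure.vitaliFamily μ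
      1).ae_tendsto_measure_inter_div_of_measurableSet hA.compl
    filter_upwards [hdens] with x hx hxA
    set y : ℕ → E := fun k => z + (1 - (1 / 2 : ℝ) ^ k) • (x - z) with hy
    set s : ℕ → ℝ := fun k => (1 / 2 : ℝ) ^ k * r with hs
    have hs0 : ∀ k, 0 < s k := fun k => by positivity
    have hp1 : ∀ k : ℕ, (1 / 2 : ℝ) ^ k ≤ 1 := fun k => pow_le_one₀ (by norm_num) (by norm_num)
    have hxz : ‖x - z‖ ≤ r := mem_closedBall_iff_norm.1 (hAr hxA)
    have hyz : ∀ k, ‖y k - z‖ + s k ≤ r := fun k => by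
      have : ‖y k - z‖ = (1 - (1 / 2 : ℝ) ^ k) * ‖x - z‖ := by
        rw [hy]
        simp only [add_sub_cancel_left]
        rw [norm_smul, Real.norm_of_nonneg (by linarith [hp1 k])]
      rw [this, hs]
      nlinarith [hp1 k]
    have hxy : ∀ k, x ∈ closedBall (y k) (s k) := fun k => by
      rw [mem_closedBall_iff_norm]
      have : x - y k = (1 / 2 : ℝ) ^ k • (x - z) := by rw [hy]; module
      rw [this, norm_smul, Real.norm_of_nonneg (by positivity)]
      simp only [hs]
      gcongr
    have hsub : ∀ k, closedBall (y k) (s k) ⊆ closedBall z r := fun k =>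
      closedBall_subset_closedBall' (by rw [dist_eq_norm]; linarith [hyz k])
    have hex : ∃ k, ¬ μ (closedBall (y k) (s k)) ≤ M * μ (closedBall (y k) (s k) \ A) := by
      by_contra! hcon
      have hst : Tendsto s atTop (𝓝[>] 0) := by
        refine tendsto_nhdsWithin_iff.2 ⟨?_, .of_forall hs0⟩
        have := (tendsto_pow_atTop_nhds_zero_of_lt_one (r := (1 / 2 : ℝ)) (by norm_num)
          (by norm_num)).mul_const r
        rwa [zero_mul] at this
      have h1 := hx.comp (IsUnifLocDoublingMeasure.tendsto_closedBall_filterAt μ (K := 1) y s hst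
        (.of_forall fun k => by rw [one_mul]; exact hxy k))
      rw [indicator_of_notMem (by simpa using hxA)] at h1
      have h2 := ENNReal.Tendsto.const_mul h1 (Or.inr hM)
      rw [mul_zero] at h2
      refine absurd (ge_of_tendsto' h2 (b := 1) fun k => ?_) (by simp)
      have hpos : μ (closedBall (y k) (s k)) ≠ 0 := (measure_closedBall_pos μ _ (hs0 k)).ne'
      have hfin : μ (closedBall (y k) (s k)) ≠ ⊤ := measure_closedBall_lt_top.ne
      simp only [Function.comp]
      rw [← mul_div_assoc, ENNReal.le_div_iff_mul_le (Or.inl hpos) (Or.inl hfin), one_mul,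
        inter_comm, ← sdiff_eq]
      exact hcon k
    classical
    set k := Nat.find hex with hk
    have hk1 := Nat.find_spec hex
    have hsub3 := (hd (y k) (s k) (hs0 k) (hsub k) (hyz k)).resolve_left hk1
    rcases Nat.eq_zero_or_pos k with h0 | h0
    · refine absurd (fun v hv => hsub3 ⟨?_, hv⟩) hfull
      have hy0 : y k = z := by rw [h0, hy]; simp
      have hsr : s k = r := by rw [h0, hs]; simp
      rw [hy0, hsr]
      exact closedBall_subset_closedBall (by linarith) hv
    · obtain ⟨j, hj⟩ := Nat.exists_eq_add_of_lt h0
      rw [zero_add] at hj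
      have hjs : s j = 2 * s k := by rw [hj, hs]; simp only [pow_succ]; ring
      have hjy : ‖y j - y k‖ ≤ s k := by
        have : y j - y k = -((1 / 2 : ℝ) ^ k • (x - z)) := by
          rw [hj, hy]; simp only [pow_succ]; module
        rw [this, norm_neg, norm_smul, Real.norm_of_nonneg (by positivity)]
        simp only [hs]
        gcongr
      refine ⟨(y j, s j), ⟨hs0 j, ?_, fun v hv => hsub3 ⟨?_, hsub j hv⟩, ?_⟩, hxy j⟩
      · simp only [hs]
        nlinarith [hp1 j]
      · exact closedBall_subset_closedBall' (by rw [dist_eq_norm]; linarith) hv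
      · exact not_not.1 (Nat.find_min hex (m := j) (by omega))
  obtain ⟨u, hut, hdisj, hu⟩ := Vitali.exists_disjoint_subfamily_covering_enlargement_closedBall
    t Prod.fst Prod.snd r (fun q hq => hq.2.1) 5 (by norm_num)
  have hcount : u.Countable := hdisj.countable_of_nonempty_interior fun q hq =>
    ⟨q.1, mem_interior_iff_mem_nhds.2 (closedBall_mem_nhds _ (hut hq).1)⟩
  calc μ A ≤ μ (⋃ q ∈ u, closedBall q.1 (5 * q.2)) := by
        refine measure_mono_ae ?_
        filter_upwards [hcov] with x hx hxA
        obtain ⟨q, hq, hxq⟩ := hx hxA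
        obtain ⟨q', hq', hsub⟩ := hu q hq
        exact mem_biUnion hq' (hsub hxq)
    _ ≤ ∑' q : u, μ (closedBall q.1.1 (5 * q.1.2)) := measure_biUnion_le _ hcount _
    _ ≤ ∑' q : u, ENNReal.ofReal (5 ^ Module.finrank ℝ E) * M *
          μ (closedBall q.1.1 q.1.2 \ A) := by
        refine ENNReal.tsum_le_tsum fun q => ?_
        rw [Measure.addHaar_closedBall_mul_of_pos _ _ (by norm_num : (0 : ℝ) < 5), mul_assoc,
          ← Measure.addHaar_closedBall_center μ q.1.1]
        gcongr
        exact (hut q.2).2.2.2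
    _ = ENNReal.ofReal (5 ^ Module.finrank ℝ E) * M *
          μ (⋃ q ∈ u, closedBall q.1 q.2 \ A) := by
        rw [ENNReal.tsum_mul_left, measure_biUnion hcount
          (hdisj.mono fun q => sdiff_subset) fun q _ => measurableSet_closedBall.diff hA]
    _ ≤ _ := by
        gcongr
        refine iUnion₂_subset fun q hq => ?_
        exact sdiff_subset_sdiff_left (hut hq).2.2.1

theorem JetSuper.exists_growth {l K : ℝ} (hl : 0 < l) (hlK : l ≤ K) :
    ∃ M : ENNReal, M ≠ ⊤ ∧ ∃ c : ℝ, 0 < c ∧ c ≤ 1 ∧ ∀ (b f r h : ℝ) (z : E) (w : E → ℝ),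
      0 ≤ b → 0 ≤ f → 0 < r → 0 < h → b * (4 * r) ≤ 1 → f * (4 * r) ^ 2 ≤ c * h →
      ContinuousOn w (closedBall z (4 * r)) → (∀ x ∈ closedBall z (4 * r), 0 ≤ w x) →
      JetSuper l K b f (ball z (4 * r)) w →
      μH[Module.finrank ℝ E] (closedBall z r) ≤
        M * μH[Module.finrank ℝ E] {x ∈ closedBall z r | w x < h} ∨
      ∀ x ∈ closedBall z (3 * r), c * h ≤ w x := by
  obtain ⟨M, hM, hgrow⟩ := JetSuper.exists_measure_sublevel (E := E) hl hlK
  obtain ⟨c, hc0, hc1, hbar⟩ := JetSuper.exists_barrier (E := E) hl (hl.le.trans hlK)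
  refine ⟨M, hM, c / 32, by positivity, by linarith, ?_⟩
  intro b f r h z w hb hf hr hh hbr hfr hwc hw0 hJ
  refine or_iff_not_imp_left.2 fun hdense x hx => ?_
  have hsub : closedBall z r ⊆ closedBall z (4 * r) := closedBall_subset_closedBall (by linarith)
  have hch : c * h ≤ h := by nlinarith
  have hhalf : ∀ y ∈ closedBall z (r / 2), h / 8 ≤ w y := by
    intro y hy
    by_contra! hlt
    refine hdense (hgrow b f r h z w hb hf hr hh (by nlinarith) (by nlinarith) (hwc.mono hsub)
      (fun v hv => hw0 v (hsub hv)) (hJ.mono (ball_subset_ball (by linarith))) y hy hlt.le)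
  have h1 := hbar b f (4 * r) (h / 8) z w hb (by positivity) (by positivity) hbr
    (by linarith [mul_pos hc0 hh]) hwc hw0 hJ (fun y hy => hhalf y
      (closedBall_subset_closedBall (by linarith) hy)) x
      (closedBall_subset_closedBall (by linarith) hx)
  have h2 : ‖x - z‖ / (4 * r) ≤ 3 / 4 := by
    rw [div_le_iff₀ (by positivity)]
    linarith [mem_closedBall_iff_norm.1 hx]
  have h3 : c * (h / 8) * (1 / 4) ≤ c * (h / 8) * (1 - ‖x - z‖ / (4 * r)) := by
    gcongr
    linarith
  linarith

theorem JetSuper.exists_measure_superlevel {l K : ℝ} (hl : 0 < l) (hlK : l ≤ K) :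
    ∃ M : ENNReal, M ≠ ⊤ ∧ ∃ c : ℝ, 0 < c ∧ c ≤ 1 ∧ ∀ (b f r h : ℝ) (z : E) (w : E → ℝ),
      0 ≤ b → 0 ≤ f → 0 < r → 0 < h → b * (4 * r) ≤ 1 → f * (4 * r) ^ 2 ≤ c * h →
      ContinuousOn w (closedBall z (4 * r)) → (∀ x ∈ closedBall z (4 * r), 0 ≤ w x) →
      JetSuper l K b f (ball z (4 * r)) w →
      (∀ x ∈ closedBall z r, c * h ≤ w x) ∨
      μH[Module.finrank ℝ E] {x ∈ closedBall z r | h ≤ w x} ≤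
        M * μH[Module.finrank ℝ E]
          ({x ∈ closedBall z r | c * h ≤ w x} \ {x ∈ closedBall z r | h ≤ w x}) := by
  obtain ⟨M, hM, c, hc0, hc1, hgrow⟩ := JetSuper.exists_growth (E := E) hl hlK
  refine ⟨ENNReal.ofReal (5 ^ Module.finrank ℝ E) * M,
    ENNReal.mul_ne_top ENNReal.ofReal_ne_top hM, c, hc0, hc1, ?_⟩
  intro b f r h z w hb hf hr hh hbr hfr hwc hw0 hJ
  have hsub : closedBall z r ⊆ closedBall z (4 * r) := closedBall_subset_closedBall (by linarith)
  have hmeas : MeasurableSet {x ∈ closedBall z r | h ≤ w x} :=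
    ((hwc.mono hsub).preimage_isClosed_of_isClosed isClosed_closedBall
      (isClosed_Ici (a := h))).measurableSet
  refine (measure_le_measure_diff_of_dense_balls μH[Module.finrank ℝ E] hM hr hmeas
    (A' := {x ∈ closedBall z r | c * h ≤ w x}) (fun x hx => hx.1) ?_).imp
    (fun hx x hxr => (hx hxr).2) id
  intro y s hs hys hyr
  have hsr : s ≤ r := by linarith [norm_nonneg (y - z)]
  have hball : ‖y - z‖ + 4 * s ≤ 4 * r := by linarith
  have hsub4 : closedBall y (4 * s) ⊆ closedBall z (4 * r) :=
    closedBall_subset_closedBall' (by rw [dist_eq_norm]; linarith)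
  have hsub4' : ball y (4 * s) ⊆ ball z (4 * r) :=
    ball_subset_ball' (by rw [dist_eq_norm]; linarith)
  refine (hgrow b f s h y w hb hf hs hh (le_trans (by gcongr) hbr) (le_trans (by gcongr) hfr)
    (hwc.mono hsub4) (fun v hv => hw0 v (hsub4 hv)) (hJ.mono hsub4')).imp (fun hy => ?_)
    (fun hy x hx => ⟨hx.2, hy x hx.1⟩)
  refine hy.trans ?_
  gcongr
  exact fun v hv => ⟨hv.1, fun hv' => hv.2.not_ge hv'.2⟩

/-- A supersolution that is at least `h` on half of a ball is bounded below on that ball. -/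
theorem JetSuper.exists_le_of_half_measure {l K : ℝ} (hl : 0 < l) (hlK : l ≤ K) :
    ∃ c : ℝ, 0 < c ∧ c ≤ 1 ∧ ∀ (b f r h : ℝ) (z : E) (w : E → ℝ),
      0 ≤ b → 0 ≤ f → 0 < r → 0 < h → b * (4 * r) ≤ 1 → f * (4 * r) ^ 2 ≤ c * h →
      ContinuousOn w (closedBall z (4 * r)) → (∀ x ∈ closedBall z (4 * r), 0 ≤ w x) →
      JetSuper l K b f (ball z (4 * r)) w →
      μH[Module.finrank ℝ E] (closedBall z r) ≤
        2 * μH[Module.finrank ℝ E] {x ∈ closedBall z r | h ≤ w x} →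
      ∀ x ∈ closedBall z r, c * h ≤ w x := by
  obtain ⟨M, hM, c, hc0, hc1, hstep⟩ := JetSuper.exists_measure_superlevel (E := E) hl hlK
  obtain ⟨N, hN⟩ := exists_nat_gt M.toReal
  refine ⟨c ^ N, by positivity, pow_le_one₀ hc0.le hc1, ?_⟩
  intro b f r h z w hb hf hr hh hbr hfr hwc hw0 hJ hhalf x hx
  set μ : Measure E := μH[Module.finrank ℝ E] with hμ
  by_contra! hlt
  set A : ℕ → Set E := fun j => {x ∈ closedBall z r | c ^ j * h ≤ w x} with hA
  have hsub : closedBall z r ⊆ closedBall z (4 * r) := closedBall_subset_closedBall (by linarith)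
  have hmeas : ∀ j, MeasurableSet (A j) := fun j =>
    ((hwc.mono hsub).preimage_isClosed_of_isClosed isClosed_closedBall
      (isClosed_Ici (a := c ^ j * h))).measurableSet
  have hfin : μ (closedBall z r) ≠ ⊤ := measure_closedBall_lt_top.ne
  have hAr : ∀ j, A j ⊆ closedBall z r := fun j x hx => hx.1
  have hAfin : ∀ j, μ (A j) ≠ ⊤ := fun j => measure_ne_top_of_subset (hAr j) hfin
  have hAsub : ∀ j, A j ⊆ A (j + 1) := fun j x hx => ⟨hx.1, le_trans (by
    rw [pow_succ]; gcongr; exact mul_le_of_le_one_right (by positivity) hc1) hx.2⟩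
  have hgrow : ∀ j < N, μ.real (A j) ≤ M.toReal * (μ.real (A (j + 1)) - μ.real (A j)) := by
    intro j hj
    have hcN : c ^ N ≤ c ^ (j + 1) := pow_le_pow_of_le_one hc0.le hc1 hj
    have hcj : c * (c ^ j * h) = c ^ (j + 1) * h := by ring
    have h1 := hstep b f r (c ^ j * h) z w hb hf hr (by positivity) hbr
      (hfr.trans (by rw [hcj]; gcongr)) hwc hw0 hJ
    rw [hcj] at h1
    rcases h1 with h1 | h1
    · have h2 : c ^ N * h ≤ c ^ (j + 1) * h := by gcongr
      linarith [h1 x hx]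
    · rw [← measureReal_sdiff (hAsub j) (hmeas j) (hAfin _)]
      rw [measureReal_def, measureReal_def, ← ENNReal.toReal_mul]
      exact ENNReal.toReal_mono (ENNReal.mul_ne_top hM
        (measure_ne_top_of_subset sdiff_subset (hAfin _))) h1
  have hV : 0 < μ.real (closedBall z r) :=
    ENNReal.toReal_pos (measure_closedBall_pos μ _ hr).ne' hfin
  have h0 : μ.real (closedBall z r) ≤ 2 * μ.real (A 0) := by
    have := ENNReal.toReal_mono (ENNReal.mul_ne_top ENNReal.ofNat_ne_top (hAfin 0))
      (show μ (closedBall z r) ≤ 2 * μ (A 0) by simpa [hA] using hhalf)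
    rwa [ENNReal.toReal_mul] at this
  have hmono : ∀ j, μ.real (A 0) ≤ μ.real (A j) := by
    intro j
    induction j with
    | zero => exact le_rfl
    | succ j ih => exact ih.trans (measureReal_mono (hAsub j) (hAfin _))
  have hind : ∀ j ≤ N, j * μ.real (A 0) ≤ M.toReal * (μ.real (A j) - μ.real (A 0)) := by
    intro j
    induction j with
    | zero => simp
    | succ j ih =>
      intro hj
      have h2 := ih (by omega)
      have h3 := hgrow j (by omega)
      push_cast
      linarith [hmono j]
  have h1 := hind N le_rfl
  have h2 : μ.real (A N) ≤ μ.real (closedBall z r) := measureReal_mono (hAr N) hfin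
  have h3 : M.toReal * (μ.real (A N) - μ.real (A 0)) ≤ M.toReal * μ.real (A 0) := by
    gcongr
    linarith
  have h4 : M.toReal * μ.real (A 0) < N * μ.real (A 0) :=
    mul_lt_mul_of_pos_right hN (by linarith)
  linarith

end InkSpots

section HalfSpace

open MeasureTheory

variable {E : Type*} [NormedAddCommGroup E] [InnerProductSpace ℝ E]

/-- `G` is a continuous supersolution in the half ball of radius `ρ` with inner normal `ν` and is
nonnegative on the flat part of its boundary. -/
structure HalfBallSuper (l K b f ρ : ℝ) (ν : E) (G : E → ℝ) : Prop where
  cont : ContinuousOn G (closedBall 0 ρ ∩ {x | 0 ≤ inner ℝ ν x})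
  nonneg : ∀ x ∈ closedBall (0 : E) ρ, inner ℝ ν x = 0 → 0 ≤ G x
  jet : JetSuper l K b f (ball 0 ρ ∩ {x | 0 < inner ℝ ν x}) G

/-- `G` lies above the linear function of slope `m` in the normal direction near the origin. -/
def EventuallyAbove (ν : E) (G : E → ℝ) (m : ℝ) : Prop :=
  ∀ᶠ x in 𝓝[{x | 0 < inner ℝ ν x}] 0, m * inner ℝ ν x ≤ G x

theorem EventuallyAbove.mono {ν : E} {G : E → ℝ} {m m' : ℝ} (h : EventuallyAbove ν G m)
    (hm : m' ≤ m) : EventuallyAbove ν G m' := by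
  filter_upwards [h, self_mem_nhdsWithin] with x hx hx0
  exact (mul_le_mul_of_nonneg_right hm (le_of_lt hx0)).trans hx

theorem norm_sub_inner_smul_sq {ν : E} (hν : ‖ν‖ = 1) (x : E) :
    ‖x - inner ℝ ν x • ν‖ ^ 2 = ‖x‖ ^ 2 - inner ℝ ν x ^ 2 := by
  rw [norm_sub_sq_real, norm_smul, real_inner_smul_right, real_inner_comm, hν, mul_one,
    Real.norm_eq_abs, sq_abs]
  ring

theorem norm_sub_inner_smul_le {ν : E} (hν : ‖ν‖ = 1) (x : E) :
    ‖x - inner ℝ ν x • ν‖ ≤ ‖x‖ :=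
  le_of_sq_le_sq (by rw [norm_sub_inner_smul_sq hν]; linarith [sq_nonneg (inner ℝ ν x)])
    (norm_nonneg _)

theorem abs_inner_le_norm_of_norm_one {ν : E} (hν : ‖ν‖ = 1) (x : E) : |inner ℝ ν x| ≤ ‖x‖ := by
  simpa [hν] using abs_real_inner_le_norm ν x

theorem inner_sub_inner_smul {ν : E} (hν : ‖ν‖ = 1) (x : E) :
    inner ℝ ν (x - inner ℝ ν x • ν) = 0 := by
  rw [inner_sub_right, real_inner_smul_right, real_inner_self_eq_norm_sq, hν]
  ring

theorem HalfBallSuper.exists_eventuallyAbove [ProperSpace E] {l K b f ρ₀ : ℝ} {ν : E} {G : E → ℝ}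
    (hl : 0 < l) (hK : 0 ≤ K) (hb : 0 ≤ b) (hf : 0 ≤ f) (hρ₀ : 0 < ρ₀) (hν : ‖ν‖ = 1)
    (hG : HalfBallSuper l K b f ρ₀ ν G) : ∃ m, EventuallyAbove ν G m := by
  have hclosed : IsClosed {x : E | 0 ≤ inner ℝ ν x} :=
    isClosed_le continuous_const (by fun_prop)
  obtain ⟨K₀, hK₀⟩ := ((isCompact_closedBall (0 : E) ρ₀).inter_right
    hclosed).exists_bound_of_continuousOn hG.cont
  have hK₀0 : 0 ≤ K₀ := (norm_nonneg _).trans (hK₀ 0 ⟨mem_closedBall_self hρ₀.le, by simp⟩)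
  set ρ := min (ρ₀ / 2) (l / (6 * (b + 1))) with hρ
  have hρ0 : 0 < ρ := by positivity
  have hρρ : 2 * ρ ≤ ρ₀ := by linarith [min_le_left (ρ₀ / 2) (l / (6 * (b + 1)))]
  have hbρ : 3 * b * ρ ≤ l / 2 := by
    have h1 : ρ * (6 * (b + 1)) ≤ l := by
      rw [← le_div_iff₀ (by positivity)]
      exact min_le_right _ _
    nlinarith
  set A := K₀ / ρ ^ 2 with hA
  have hA0 : 0 ≤ A := by positivity
  have hAρ : A * ρ ^ 2 = K₀ := by rw [hA]; field_simp
  set B := 2 * (K * A + 2 * b * A * ρ + f + 1) / l with hB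
  have hB0 : 0 ≤ B := by positivity
  have hlB : l * B = 2 * (K * A + 2 * b * A * ρ + f + 1) := by rw [hB]; field_simp
  refine ⟨-(A * ρ + B * ρ), ?_⟩
  filter_upwards [self_mem_nhdsWithin, mem_nhdsWithin_of_mem_nhds (ball_mem_nhds (0 : E) hρ0)]
    with x hx0 hxρ
  rw [mem_ball_zero_iff] at hxρ
  set t := inner ℝ ν x with ht
  have ht0 : 0 < t := hx0
  set z := x - t • ν with hz
  have hzν : inner ℝ ν z = 0 := inner_sub_inner_smul hν x
  have hzρ : ‖z‖ ≤ ρ := (norm_sub_inner_smul_le hν x).trans hxρ.le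
  have hxz : ‖x - z‖ = t := by
    rw [hz, sub_sub_cancel, norm_smul, hν, mul_one, Real.norm_of_nonneg ht0.le]
  have htρ : t ≤ ρ := by
    have := abs_inner_le_norm_of_norm_one hν x
    linarith [le_abs_self (inner ℝ ν x)]
  clear_value z t
  set φ : E → ℝ := fun y => -A * ‖y - z‖ ^ 2 + B * inner ℝ ν y ^ 2 - B * ρ * inner ℝ ν y with hφ
  set S := closedBall z ρ ∩ {y | 0 ≤ inner ℝ ν y} with hS
  have hSc : IsCompact S := (isCompact_closedBall z ρ).inter_right hclosed
  have hS0 : ∀ y ∈ closedBall z ρ, y ∈ closedBall (0 : E) ρ₀ := fun y hy => by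
    have h1 := mem_closedBall_iff_norm.1 hy
    rw [mem_closedBall_zero_iff]
    have h2 := norm_add_le (y - z) z
    rw [sub_add_cancel] at h2
    linarith
  have hxS : x ∈ S := ⟨by rw [mem_closedBall_iff_norm, hxz]; exact htρ, by simpa [← ht] using ht0.le⟩
  obtain ⟨y₀, ⟨hy₀, hy₀n⟩, hmin⟩ := hSc.exists_isMinOn (f := fun y => G y - φ y) ⟨x, hxS⟩
    ((hG.cont.mono fun y hy => ⟨hS0 y hy.1, hy.2⟩).sub (Continuous.continuousOn (by fun_prop)))
  rw [isMinOn_iff] at hmin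
  have hs : inner ℝ ν y₀ ≤ ‖y₀ - z‖ := by
    have := abs_inner_le_norm_of_norm_one hν (y₀ - z)
    rw [inner_sub_right, hzν, sub_zero] at this
    exact (le_abs_self _).trans this
  have hyρ := mem_closedBall_iff_norm.1 hy₀
  have hsB : B * inner ℝ ν y₀ ^ 2 ≤ B * ρ * inner ℝ ν y₀ := by
    have : inner ℝ ν y₀ * inner ℝ ν y₀ ≤ ρ * inner ℝ ν y₀ :=
      mul_le_mul_of_nonneg_right (hs.trans hyρ) hy₀n
    nlinarith
  have hpos : 0 ≤ G y₀ - φ y₀ := by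
    rcases eq_or_lt_of_le (show 0 ≤ inner ℝ ν y₀ from hy₀n) with h0 | h0
    · have h1 := hG.nonneg y₀ (hS0 y₀ hy₀) h0.symm
      have h2 : 0 ≤ A * ‖y₀ - z‖ ^ 2 := by positivity
      simp only [hφ]
      linarith
    rcases eq_or_lt_of_le hyρ with h1 | h1
    · have h2 := neg_le_of_abs_le (hK₀ y₀ ⟨hS0 y₀ hy₀, hy₀n⟩)
      simp only [hφ, h1]
      linarith
    exfalso
    have hy₀b : y₀ ∈ ball (0 : E) ρ₀ := by
      rw [mem_ball_zero_iff]
      have h2 := norm_add_le (y₀ - z) z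
      rw [sub_add_cancel] at h2
      linarith
    set p : E := -((2 * A) • (y₀ - z)) + (2 * B * inner ℝ ν y₀ - B * ρ) • ν with hp
    have hnp : ‖p‖ ≤ 2 * A * ρ + 3 * B * ρ := by
      refine (norm_add_le _ _).trans ?_
      rw [norm_neg, norm_smul, norm_smul, hν, mul_one, Real.norm_of_nonneg (by positivity)]
      have h3 : 2 * A * ‖y₀ - z‖ ≤ 2 * A * ρ := by gcongr
      have h4 : B * inner ℝ ν y₀ ≤ B * ρ := by gcongr; exact hs.trans hyρ
      have h5 : 0 ≤ B * inner ℝ ν y₀ := by positivity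
      have h6 : ‖2 * B * inner ℝ ν y₀ - B * ρ‖ ≤ 3 * B * ρ := by
        rw [Real.norm_eq_abs, abs_le]
        constructor <;> linarith
      linarith
    have h2 := hG.jet y₀ ⟨hy₀b, h0⟩ p ν B A hB0 hA0 (by
      have hopen : IsOpen {y : E | 0 < inner ℝ ν y} := isOpen_lt continuous_const (by fun_prop)
      filter_upwards [isOpen_ball.eventually_mem (mem_ball_iff_norm.2 h1),
        hopen.eventually_mem h0] with y hy1 hy2
      have h3 := hmin y ⟨ball_subset_closedBall hy1, le_of_lt hy2⟩
      have h4 : φ y - φ y₀ = inner ℝ p (y - y₀) + B * inner ℝ ν (y - y₀) ^ 2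
          - A * ‖y - y₀‖ ^ 2 := by
        have h5 : ‖y - z‖ ^ 2 = ‖y - y₀‖ ^ 2 + 2 * inner ℝ (y₀ - z) (y - y₀)
            + ‖y₀ - z‖ ^ 2 := by
          rw [real_inner_comm, ← norm_add_sq_real, sub_add_sub_cancel]
        have h6 : inner ℝ ν y = inner ℝ ν (y - y₀) + inner ℝ ν y₀ := by
          rw [← inner_add_right, sub_add_cancel]
        simp only [hφ, hp]
        rw [h5, h6, inner_add_left, inner_neg_left, real_inner_smul_left, real_inner_smul_left]
        ring
      linarith)
    rw [hν] at h2
    have h3 : b * ‖p‖ ≤ b * (2 * A * ρ + 3 * B * ρ) := by gcongr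
    have h4 := mul_le_mul_of_nonneg_right hbρ hB0
    linarith
  have h1 := hmin x hxS
  have h2 : φ x = -A * t ^ 2 + B * t ^ 2 - B * ρ * t := by
    simp only [hφ]
    rw [hxz, ← ht]
  have h3 : A * (t * t) ≤ A * (ρ * t) := by gcongr
  have h4 : 0 ≤ B * t ^ 2 := by positivity
  linarith

variable [FiniteDimensional ℝ E] [MeasurableSpace E] [BorelSpace E]

theorem JetSuper.exists_eventuallyAbove_of_half_measure {l K : ℝ} (hl : 0 < l) (hlK : l ≤ K) :
    ∃ c : ℝ, 0 < c ∧ ∀ (b f D H : ℝ) (ν : E) (W : E → ℝ), 0 ≤ b → 0 ≤ f → 0 < D → 0 < H →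
      ‖ν‖ = 1 → b * H ≤ 1 → f * H ≤ c * D →
      ContinuousOn W (closedBall 0 (3 * H) ∩ {x | 0 ≤ inner ℝ ν x}) →
      (∀ x ∈ closedBall 0 (3 * H) ∩ {x | 0 ≤ inner ℝ ν x}, 0 ≤ W x) →
      JetSuper l K b f (ball 0 (3 * H) ∩ {x | 0 < inner ℝ ν x}) W →
      μH[Module.finrank ℝ E] (closedBall (H • ν) (H / 4)) ≤
        2 * μH[Module.finrank ℝ E] {x ∈ closedBall (H • ν) (H / 4) | D * H / 4 ≤ W x} →
      EventuallyAbove ν W (c * D) := by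
  obtain ⟨c₀, hc₀, hc₀1, hbar⟩ := JetSuper.exists_barrier (E := E) hl (hl.le.trans hlK)
  obtain ⟨c₁, hc₁, hc₁1, hks⟩ := JetSuper.exists_le_of_half_measure (E := E) hl hlK
  refine ⟨c₀ * c₁ / 4, by positivity, ?_⟩
  intro b f D H ν W hb hf hD hH hν hbH hfH hWc hW0 hJ hhalf
  have hball : ∀ y : E, inner ℝ ν y = 0 → ‖y‖ ≤ H / 16 → ∀ x ∈ closedBall (y + H • ν) H,
      x ∈ closedBall (0 : E) (3 * H) ∩ {x | 0 ≤ inner ℝ ν x} := by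
    intro y hy hyH x hx
    have h1 := mem_closedBall_iff_norm.1 hx
    constructor
    · rw [mem_closedBall_zero_iff]
      have h2 := norm_add_le (x - (y + H • ν)) (y + H • ν)
      have h3 := norm_add_le y (H • ν)
      rw [sub_add_cancel] at h2
      rw [norm_smul, hν, Real.norm_of_nonneg hH.le] at h3
      linarith
    · have h2 := (neg_le_abs _).trans
        ((abs_inner_le_norm_of_norm_one hν (x - (y + H • ν))).trans h1)
      rw [inner_sub_right, inner_add_right, hy, real_inner_smul_right,
        real_inner_self_eq_norm_sq, hν] at h2
      show 0 ≤ inner ℝ ν x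
      linarith
  have hball' : ∀ y : E, inner ℝ ν y = 0 → ‖y‖ ≤ H / 16 → ball (y + H • ν) H ⊆
      ball (0 : E) (3 * H) ∩ {x | 0 < inner ℝ ν x} := by
    intro y hy hyH x hx
    have h1 := mem_ball_iff_norm.1 hx
    constructor
    · rw [mem_ball_zero_iff]
      have h2 := norm_add_le (x - (y + H • ν)) (y + H • ν)
      have h3 := norm_add_le y (H • ν)
      rw [sub_add_cancel] at h2
      rw [norm_smul, hν, Real.norm_of_nonneg hH.le] at h3
      linarith
    · have h2 := (neg_le_abs _).trans_lt
        ((abs_inner_le_norm_of_norm_one hν (x - (y + H • ν))).trans_lt h1)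
      rw [inner_sub_right, inner_add_right, hy, real_inner_smul_right,
        real_inner_self_eq_norm_sq, hν] at h2
      show 0 < inner ℝ ν x
      linarith
  have hfH2 : f * H ^ 2 ≤ c₀ * (c₁ * (D * H / 4)) := by
    have := mul_le_mul_of_nonneg_right hfH hH.le
    nlinarith
  have hfH3 : c₀ * (c₁ * (D * H / 4)) ≤ c₁ * (D * H / 4) :=
    mul_le_of_le_one_left (by positivity) hc₀1
  have h4H : 4 * (H / 4) = H := by ring
  have hb0 := hball 0 (inner_zero_right _) (by rw [norm_zero]; positivity)
  have hb0' := hball' 0 (inner_zero_right _) (by rw [norm_zero]; positivity)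
  rw [zero_add] at hb0 hb0'
  have hW := hks b f (H / 4) (D * H / 4) (H • ν) W hb hf (by positivity) (by positivity)
    (by rwa [h4H]) (by rw [h4H]; linarith) (by rw [h4H]; exact hWc.mono hb0)
    (fun x hx => hW0 x (hb0 x (by rwa [h4H] at hx))) (by rw [h4H]; exact hJ.mono hb0') hhalf
  filter_upwards [self_mem_nhdsWithin, mem_nhdsWithin_of_mem_nhds
    (ball_mem_nhds (0 : E) (show 0 < H / 16 by positivity))] with x hx0 hxH
  rw [mem_ball_zero_iff] at hxH
  set t := inner ℝ ν x with ht
  have ht0 : 0 < t := hx0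
  set y := x - t • ν with hy
  have hyν : inner ℝ ν y = 0 := inner_sub_inner_smul hν x
  have hyH : ‖y‖ ≤ H / 16 := (norm_sub_inner_smul_le hν x).trans hxH.le
  have htH : t ≤ H := by
    have := abs_inner_le_norm_of_norm_one hν x
    linarith [le_abs_self (inner ℝ ν x)]
  have hxy : ‖x - (y + H • ν)‖ = H - t := by
    have : x - (y + H • ν) = -((H - t) • ν) := by rw [hy]; module
    rw [this, norm_neg, norm_smul, hν, mul_one, Real.norm_of_nonneg (by linarith)]
  have h1 := hbar b f H (c₁ * (D * H / 4)) (y + H • ν) W hb hH (by positivity) hbH hfH2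
    (hWc.mono (hball y hyν hyH)) (fun v hv => hW0 v (hball y hyν hyH v hv))
    (hJ.mono (hball' y hyν hyH)) (fun v hv => hW v (by
      rw [mem_closedBall_iff_norm] at hv ⊢
      have h2 := norm_add_le (v - (y + H • ν)) y
      rw [show v - (y + H • ν) + y = v - H • ν by module] at h2
      linarith)) x (by rw [mem_closedBall_iff_norm, hxy]; linarith)
  rw [hxy] at h1
  refine le_of_eq_of_le ?_ h1
  field_simp
  ring

theorem HalfBallSuper.exists_slope {l K b f ρ₀ : ℝ} {ν : E} {G G' : E → ℝ}
    (hl : 0 < l) (hlK : l ≤ K) (hb : 0 ≤ b) (hf : 0 ≤ f) (hρ₀ : 0 < ρ₀) (hν : ‖ν‖ = 1)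
    (hG : HalfBallSuper l K b f ρ₀ ν G) (hG' : HalfBallSuper l K b f ρ₀ ν G')
    (hadd : ∀ x, 0 ≤ G x + G' x) (haxis : ∀ t : ℝ, G (t • ν) + G' (t • ν) = 0) :
    ∃ L, (∀ δ > 0, EventuallyAbove ν G (L - δ)) ∧ (∀ m, EventuallyAbove ν G m → m ≤ L) ∧
      (∀ δ > 0, EventuallyAbove ν G' (-L - δ)) ∧ (∀ m, EventuallyAbove ν G' m → m ≤ -L) := by
  have hK : 0 ≤ K := hl.le.trans hlK
  have hpair : ∀ m m', EventuallyAbove ν G m → EventuallyAbove ν G' m' → m + m' ≤ 0 := by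
    intro m m' hm hm'
    have hlim : Tendsto (fun t : ℝ => t • ν) (𝓝[>] 0) (𝓝[{x | 0 < inner ℝ ν x}] 0) := by
      refine tendsto_nhdsWithin_iff.2 ⟨?_, ?_⟩
      · have : Tendsto (fun t : ℝ => t • ν) (𝓝 0) (𝓝 ((0 : ℝ) • ν)) :=
          (continuous_id.smul continuous_const).tendsto 0
        rw [zero_smul] at this
        exact this.mono_left nhdsWithin_le_nhds
      · filter_upwards [self_mem_nhdsWithin] with t ht
        simpa [real_inner_smul_right, real_inner_self_eq_norm_sq, hν] using ht
    obtain ⟨t, ht1, ht0⟩ := ((hlim.eventually (hm.and hm')).and self_mem_nhdsWithin).exists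
    rw [real_inner_smul_right, real_inner_self_eq_norm_sq, hν] at ht1
    have ht0' : 0 < t := ht0
    have h1 : (m + m') * t ≤ 0 := by linarith [haxis t, ht1.1, ht1.2]
    by_contra! hlt
    linarith [mul_pos hlt ht0']
  obtain ⟨m₀, hm₀⟩ := hG.exists_eventuallyAbove hl hK hb hf hρ₀ hν
  obtain ⟨m₀', hm₀'⟩ := hG'.exists_eventuallyAbove hl hK hb hf hρ₀ hν
  set S := {m | EventuallyAbove ν G m} with hS
  set S' := {m | EventuallyAbove ν G' m} with hS'
  have hSb : BddAbove S := ⟨-m₀', fun m hm => by linarith [hpair m m₀' hm hm₀']⟩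
  have hSb' : BddAbove S' := ⟨-m₀, fun m hm => by linarith [hpair m₀ m hm₀ hm]⟩
  have hle : ∀ m, EventuallyAbove ν G m → m ≤ sSup S := fun m hm => le_csSup hSb hm
  have hle' : ∀ m, EventuallyAbove ν G' m → m ≤ sSup S' := fun m hm => le_csSup hSb' hm
  have hlt : ∀ δ > 0, EventuallyAbove ν G (sSup S - δ) := fun δ hδ => by
    obtain ⟨m, hm, hlt⟩ := exists_lt_of_lt_csSup ⟨m₀, hm₀⟩ (show sSup S - δ < sSup S by linarith)
    exact EventuallyAbove.mono hm hlt.le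
  have hlt' : ∀ δ > 0, EventuallyAbove ν G' (sSup S' - δ) := fun δ hδ => by
    obtain ⟨m, hm, hlt⟩ := exists_lt_of_lt_csSup ⟨m₀', hm₀'⟩
      (show sSup S' - δ < sSup S' by linarith)
    exact EventuallyAbove.mono hm hlt.le
  suffices hsum : sSup S' = -sSup S by
    exact ⟨sSup S, hlt, hle, hsum ▸ hlt', hsum ▸ hle'⟩
  set L := sSup S with hL
  set L' := sSup S' with hL'
  by_contra hne
  have hL0 : L + L' ≤ 0 := by
    have h1 : L ≤ -L' := csSup_le ⟨m₀, hm₀⟩ fun m hm => by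
      have h2 : L' ≤ -m := csSup_le ⟨m₀', hm₀'⟩ fun m' hm' => by linarith [hpair m m' hm hm']
      linarith
    linarith
  set D := -(L + L') with hD
  have hD0 : 0 < D := lt_of_le_of_ne (by linarith) fun h => hne (by linarith)
  obtain ⟨c, hc, himp⟩ := JetSuper.exists_eventuallyAbove_of_half_measure (E := E) hl hlK
  set δ := c * D / 2 with hδ
  have hδ0 : 0 < δ := by positivity
  set F := f + b * (|L - δ| + |L' - δ|) with hF
  have hF0 : 0 ≤ F := by positivity
  have key : ∀ (G₁ : E → ℝ) (m H : ℝ), HalfBallSuper l K b f ρ₀ ν G₁ →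
      |m| ≤ |L - δ| + |L' - δ| → 0 < H → b * H ≤ 1 → F * H ≤ c * D → 3 * H ≤ ρ₀ →
      (∀ x ∈ closedBall (0 : E) (3 * H), 0 < inner ℝ ν x → m * inner ℝ ν x ≤ G₁ x) →
      μH[Module.finrank ℝ E] (closedBall (H • ν) (H / 4)) ≤ 2 * μH[Module.finrank ℝ E]
        {x ∈ closedBall (H • ν) (H / 4) | D * H / 4 ≤ G₁ x - m * inner ℝ ν x} →
      EventuallyAbove ν G₁ (m + c * D) := by
    intro G₁ m H hG₁ hm hH hbH hFH hHρ habove hhalf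
    have hsub : closedBall (0 : E) (3 * H) ⊆ closedBall 0 ρ₀ := closedBall_subset_closedBall hHρ
    have hjet := (hG₁.jet.mono (inter_subset_inter_left {x | 0 < inner ℝ ν x}
      (ball_subset_ball hHρ))).sub_of_semiconvex (g := fun x => m * inner ℝ ν x) (P := |m|) hb le_rfl
      fun x₀ _ => ⟨m • ν, by rw [norm_smul, hν, mul_one, Real.norm_eq_abs], fun x => by
        rw [real_inner_smul_left, inner_sub_right]
        linarith⟩
    have h1 := himp b F D H ν (fun x => G₁ x - m * inner ℝ ν x) hb hF0 hD0 hH hν hbH hFH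
      ((hG₁.cont.mono (inter_subset_inter_left _ hsub)).sub
        (Continuous.continuousOn (by fun_prop))) (fun x hx => by
        rcases eq_or_lt_of_le (show 0 ≤ inner ℝ ν x from hx.2) with h0 | h0
        · have := hG₁.nonneg x (hsub hx.1) h0.symm
          rw [← h0]
          linarith
        · linarith [habove x hx.1 h0])
      (fun x₀ hx p e α β hα hβ ht => (hjet x₀ hx p e α β hα hβ ht).trans (by
        have : b * |m| ≤ b * (|L - δ| + |L' - δ|) := by gcongr
        linarith)) hhalf
    filter_upwards [h1] with x hx
    linarith
  have hev := hlt δ hδ0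
  have hev' := hlt' δ hδ0
  obtain ⟨s, hs, hball⟩ := Metric.eventually_nhds_iff_ball.1
    ((eventually_nhdsWithin_iff.1 hev).and (eventually_nhdsWithin_iff.1 hev'))
  obtain ⟨H, hH, hHs, hHρ, hbH, hFH⟩ : ∃ H : ℝ, 0 < H ∧ 3 * H < s ∧ 3 * H ≤ ρ₀ ∧ b * H ≤ 1 ∧
      F * H ≤ c * D := by
    have h1 : ∀ a d : ℝ, 0 < d → ∀ᶠ H in 𝓝[>] (0 : ℝ), a * H < d := fun a d hd => by
      have : Tendsto (fun H : ℝ => a * H) (𝓝 0) (𝓝 (a * 0)) :=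
        (continuous_const.mul continuous_id).tendsto 0
      rw [mul_zero] at this
      exact (this.mono_left nhdsWithin_le_nhds).eventually_lt_const hd
    obtain ⟨H, ⟨h2, h3⟩, ⟨h4, h5⟩, h6⟩ := (((h1 3 s hs).and (h1 3 ρ₀ hρ₀)).and
      (((h1 b 1 one_pos).and (h1 F (c * D) (by positivity))).and self_mem_nhdsWithin)).exists
    exact ⟨H, h6, h2, h3.le, h4.le, h5.le⟩
  have hin : ∀ x ∈ closedBall (0 : E) (3 * H), x ∈ ball (0 : E) s :=
    fun x hx => closedBall_subset_ball hHs hx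
  set T := closedBall (H • ν) (H / 4) with hT
  set μ : Measure E := μH[Module.finrank ℝ E] with hμ
  have hcover : T ⊆ {x ∈ T | D * H / 4 ≤ G x - (L - δ) * inner ℝ ν x} ∪
      {x ∈ T | D * H / 4 ≤ G' x - (L' - δ) * inner ℝ ν x} := by
    intro x hx
    by_contra hcon
    simp only [mem_union, mem_sep_iff, hx, true_and, not_or, not_le] at hcon
    have h1 := (neg_le_abs _).trans ((abs_inner_le_norm_of_norm_one hν (x - H • ν)).trans
      (mem_closedBall_iff_norm.1 hx))
    rw [inner_sub_right, real_inner_smul_right, real_inner_self_eq_norm_sq, hν] at h1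
    have h2 := hadd x
    have h3 : D * (3 / 4 * H) ≤ D * inner ℝ ν x := by gcongr; linarith
    have h4 : 0 ≤ δ * inner ℝ ν x := mul_nonneg hδ0.le (by linarith)
    have h5 : D * inner ℝ ν x = -(L * inner ℝ ν x) - L' * inner ℝ ν x := by rw [hD]; ring
    have h6 : 0 < D * H := by positivity
    linarith [hcon.1, hcon.2]
  have hor : μ T ≤ 2 * μ {x ∈ T | D * H / 4 ≤ G x - (L - δ) * inner ℝ ν x} ∨
      μ T ≤ 2 * μ {x ∈ T | D * H / 4 ≤ G' x - (L' - δ) * inner ℝ ν x} := by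
    by_contra! hcon
    have h1 := ENNReal.add_lt_add hcon.1 hcon.2
    rw [← mul_add, ← two_mul] at h1
    exact absurd h1 (not_lt.2 (by gcongr; exact (measure_mono hcover).trans (measure_union_le _ _)))
  rcases hor with h | h
  · have h1 := hle _ (key G (L - δ) H hG (le_add_of_nonneg_right (abs_nonneg _)) hH hbH hFH hHρ
      (fun x hx hx0 => (hball x (hin x hx)).1 hx0) h)
    linarith
  · have h1 := hle' _ (key G' (L' - δ) H hG' (le_add_of_nonneg_left (abs_nonneg _)) hH hbH hFH hHρ
      (fun x hx hx0 => (hball x (hin x hx)).2 hx0) h)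
    linarith

end HalfSpace

section Slope

variable {E : Type*} [NormedAddCommGroup E] [InnerProductSpace ℝ E]

theorem EventuallyAbove.liminf_eq_zero {ν : E} {G : E → ℝ} {L : ℝ}
    (h₁ : ∀ δ > 0, EventuallyAbove ν G (L - δ)) (h₂ : ∀ m, EventuallyAbove ν G m → m ≤ L) :
    liminf (fun x => (G x - L * inner ℝ ν x) / inner ℝ ν x) (𝓝[{x | 0 < inner ℝ ν x}] 0) = 0 := by
  have hiff : ∀ a : ℝ, (∀ᶠ x in 𝓝[{x | 0 < inner ℝ ν x}] 0,
      a ≤ (G x - L * inner ℝ ν x) / inner ℝ ν x) ↔ EventuallyAbove ν G (L + a) := fun a => by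
    refine eventually_congr ?_
    filter_upwards [self_mem_nhdsWithin] with x hx
    rw [le_div_iff₀ hx, add_mul, le_sub_iff_add_le']
  rw [liminf_eq]
  simp only [hiff]
  refine IsLUB.csSup_eq ⟨fun a ha => by linarith [h₂ _ ha], fun a ha => ?_⟩
    ⟨-1, h₁ 1 one_pos⟩
  refine le_of_forall_pos_le_add fun δ hδ => ?_
  have h3 : -δ ≤ a := ha (h₁ δ hδ)
  linarith

theorem EventuallyAbove.limsup_neg_eq_zero {ν : E} {G : E → ℝ} {L : ℝ}
    (h₁ : ∀ δ > 0, EventuallyAbove ν G (L - δ)) (h₂ : ∀ m, EventuallyAbove ν G m → m ≤ L) :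
    limsup (fun x => -((G x - L * inner ℝ ν x) / inner ℝ ν x))
      (𝓝[{x | 0 < inner ℝ ν x}] 0) = 0 := by
  have hiff : ∀ a : ℝ, (∀ᶠ x in 𝓝[{x | 0 < inner ℝ ν x}] 0,
      -((G x - L * inner ℝ ν x) / inner ℝ ν x) ≤ a) ↔ EventuallyAbove ν G (L - a) := fun a => by
    refine eventually_congr ?_
    filter_upwards [self_mem_nhdsWithin] with x hx
    rw [neg_le, le_div_iff₀ hx, le_sub_iff_add_le', sub_eq_add_neg, add_mul]
  rw [limsup_eq]
  simp only [hiff]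
  refine IsGLB.csInf_eq ⟨fun a ha => by linarith [h₂ _ ha], fun a ha => ?_⟩ ⟨1, h₁ 1 one_pos⟩
  refine le_of_forall_pos_le_add fun δ hδ => ?_
  have h3 : a ≤ δ := ha (h₁ δ hδ)
  linarith

theorem closedBall_half_inter_subset_closure {ν : E} (hν : ‖ν‖ = 1) :
    closedBall (0 : E) (1 / 2) ∩ {x | 0 ≤ inner ℝ ν x} ⊆
      closure (ball 0 1 ∩ {x | 0 < inner ℝ ν x}) := by
  rintro x ⟨hx, hx0⟩
  rw [mem_closedBall_zero_iff] at hx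
  have hlim : Tendsto (fun t : ℝ => x + t • ν) (𝓝[>] 0) (𝓝 x) := by
    have : Tendsto (fun t : ℝ => x + t • ν) (𝓝 0) (𝓝 (x + (0 : ℝ) • ν)) :=
      (continuous_const.add (continuous_id.smul continuous_const)).tendsto 0
    rw [zero_smul, add_zero] at this
    exact this.mono_left nhdsWithin_le_nhds
  refine mem_closure_of_tendsto hlim ?_
  filter_upwards [Ioo_mem_nhdsGT (show (0 : ℝ) < 1 / 2 by norm_num)] with t ht
  refine ⟨?_, ?_⟩
  · rw [mem_ball_zero_iff]
    have := norm_add_le x (t • ν)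
    rw [norm_smul, hν, Real.norm_of_nonneg ht.1.le] at this
    linarith [ht.2]
  · have h1 : 0 ≤ inner ℝ ν x := hx0
    show 0 < inner ℝ ν (x + t • ν)
    rw [inner_add_right, real_inner_smul_right, real_inner_self_eq_norm_sq, hν]
    linarith [ht.1]

theorem JetSuper.sub_linear_add_tangential_sq {l K b f κ : ℝ} {V : Set E} {w : E → ℝ} {ν : E}
    (hν : ‖ν‖ = 1) (hb : 0 ≤ b) (hκ : 0 ≤ κ) (hV : V ⊆ ball 0 1) (h : JetSuper l K b f V w)
    (P : E) : JetSuper l K b (f + K * κ + b * (‖P‖ + 4 * κ)) V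
      (fun x => w x - (inner ℝ P x - κ * (‖x‖ ^ 2 - inner ℝ ν x ^ 2))) := by
  refine h.sub_of_semiconvex hb hκ fun x₀ hx₀ =>
    ⟨P - (2 * κ) • x₀ + (2 * κ * inner ℝ ν x₀) • ν, ?_, fun x => ?_⟩
  · have h1 : ‖x₀‖ ≤ 1 := (mem_ball_zero_iff.1 (hV hx₀)).le
    have h2 := (abs_inner_le_norm_of_norm_one hν x₀).trans h1
    have h3 : ‖(2 * κ) • x₀‖ ≤ 2 * κ := by
      rw [norm_smul, Real.norm_of_nonneg (by positivity)]
      exact mul_le_of_le_one_right (by positivity) h1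
    have h4 : ‖(2 * κ * inner ℝ ν x₀) • ν‖ ≤ 2 * κ := by
      rw [norm_smul, hν, mul_one, norm_mul, Real.norm_of_nonneg (by positivity)]
      exact mul_le_of_le_one_right (by positivity) h2
    linarith [norm_add_le (P - (2 * κ) • x₀) ((2 * κ * inner ℝ ν x₀) • ν),
      norm_sub_le P ((2 * κ) • x₀)]
  · have h1 : ‖x‖ ^ 2 = ‖x₀‖ ^ 2 + 2 * inner ℝ x₀ (x - x₀) + ‖x - x₀‖ ^ 2 := by
      rw [← norm_add_sq_real, add_sub_cancel]
    have h2 : inner ℝ ν x = inner ℝ ν x₀ + inner ℝ ν (x - x₀) := by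
      rw [← inner_add_right, add_sub_cancel]
    have h3 : inner ℝ P x = inner ℝ P x₀ + inner ℝ P (x - x₀) := by
      rw [← inner_add_right, add_sub_cancel]
    rw [h1, h2, h3, inner_add_left, inner_sub_left, real_inner_smul_left, real_inner_smul_left]
    have h4 : 0 ≤ κ * inner ℝ ν (x - x₀) ^ 2 := by positivity
    linarith

/-- Boundary differentiability in coordinate-free form. -/
theorem exists_normal_derivative [FiniteDimensional ℝ E] [MeasurableSpace E] [BorelSpace E]
    {l K b f κ : ℝ} {u : E → ℝ} {ν P : E} (hl : 0 < l) (hlK : l ≤ K) (hb : 0 ≤ b) (hf : 0 ≤ f)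
    (hκ : 0 < κ) (hν : ‖ν‖ = 1)
    (hu : ContinuousOn u (closure (ball 0 1 ∩ {x | 0 < inner ℝ ν x})))
    (hsup : JetSuper l K b f (ball 0 1 ∩ {x | 0 < inner ℝ ν x}) u)
    (hsub : JetSuper l K b f (ball 0 1 ∩ {x | 0 < inner ℝ ν x}) (fun x => -u x))
    (hbdry : ∀ x ∈ ball (0 : E) 1, inner ℝ ν x = 0 →
      |u x - inner ℝ P x| ≤ κ * (‖x‖ ^ 2 - inner ℝ ν x ^ 2)) :
    ∃ L : ℝ, ((fun x => u x - (inner ℝ P x + L * inner ℝ ν x))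
        =o[𝓝[{x | 0 ≤ inner ℝ ν x}] 0] fun x => ‖x‖) ∧
      liminf (fun x => (u x - (-κ * (‖x‖ ^ 2 - inner ℝ ν x ^ 2) + inner ℝ P x
        + L * inner ℝ ν x)) / inner ℝ ν x) (𝓝[{x | 0 < inner ℝ ν x}] 0) = 0 ∧
      limsup (fun x => (u x - (κ * (‖x‖ ^ 2 - inner ℝ ν x ^ 2) + inner ℝ P x
        + L * inner ℝ ν x)) / inner ℝ ν x) (𝓝[{x | 0 < inner ℝ ν x}] 0) = 0 := by
  set Q : E → ℝ := fun x => ‖x‖ ^ 2 - inner ℝ ν x ^ 2 with hQ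
  have hQ0 : ∀ x, 0 ≤ Q x := fun x => by
    simp only [hQ]
    rw [← norm_sub_inner_smul_sq hν]
    positivity
  set G : E → ℝ := fun x => u x - (inner ℝ P x - κ * Q x) with hG
  set G' : E → ℝ := fun x => -u x - (inner ℝ (-P) x - κ * Q x) with hG'
  set F := f + K * κ + b * (‖P‖ + 4 * κ) with hF
  have hK : 0 ≤ K := hl.le.trans hlK
  have hballs : ball (0 : E) (1 / 2) ∩ {x | 0 < inner ℝ ν x} ⊆
      ball 0 1 ∩ {x | 0 < inner ℝ ν x} :=
    inter_subset_inter_left _ (ball_subset_ball (by norm_num))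
  have huc := hu.mono (closedBall_half_inter_subset_closure hν)
  have hflat : ∀ x ∈ closedBall (0 : E) (1 / 2), inner ℝ ν x = 0 →
      |u x - inner ℝ P x| ≤ κ * Q x := fun x hx =>
    hbdry x (closedBall_subset_ball (by norm_num) hx)
  have hGs : HalfBallSuper l K b F (1 / 2) ν G :=
    ⟨huc.sub (Continuous.continuousOn (by fun_prop)), fun x hx hx0 => by
      simp only [hG]
      linarith [neg_le_of_abs_le (hflat x hx hx0)],
      (hsup.sub_linear_add_tangential_sq hν hb hκ.le inter_subset_left P).mono hballs⟩
  have hGs' : HalfBallSuper l K b F (1 / 2) ν G' := by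
    refine ⟨huc.neg.sub (Continuous.continuousOn (by fun_prop)), fun x hx hx0 => ?_, ?_⟩
    · simp only [hG', inner_neg_left]
      linarith [le_of_abs_le (hflat x hx hx0)]
    · have := (hsub.sub_linear_add_tangential_sq hν hb hκ.le inter_subset_left (-P)).mono hballs
      rwa [norm_neg] at this
  obtain ⟨L, h1, h2, h3, h4⟩ := HalfBallSuper.exists_slope hl hlK hb (by positivity) (by norm_num)
    hν hGs hGs' (fun x => by
      simp only [hG, hG', inner_neg_left]
      linarith [mul_nonneg hκ.le (hQ0 x)]) (fun t => by
      simp only [hG, hG', inner_neg_left, hQ, norm_smul, real_inner_smul_right,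
        real_inner_self_eq_norm_sq, hν, Real.norm_eq_abs, mul_one, sq_abs]
      ring)
  refine ⟨L, ?_, ?_, ?_⟩
  · rw [Asymptotics.isLittleO_iff]
    intro c hc
    have hsmall : ∀ᶠ x in 𝓝[{x : E | 0 ≤ inner ℝ ν x}] 0, x ∈ ball (0 : E) (min 1 (c / (2 * κ))) :=
      mem_nhdsWithin_of_mem_nhds (ball_mem_nhds _ (by positivity))
    filter_upwards [self_mem_nhdsWithin, hsmall,
      mem_nhdsWithin_of_mem_nhds (eventually_nhdsWithin_iff.1 (h1 (c / 2) (by positivity))),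
      mem_nhdsWithin_of_mem_nhds (eventually_nhdsWithin_iff.1 (h3 (c / 2) (by positivity)))]
      with x hx0 hxs hx1 hx3
    rw [mem_ball_zero_iff, lt_min_iff, lt_div_iff₀ (by positivity)] at hxs
    have hQx : κ * Q x ≤ c / 2 * ‖x‖ := by
      have h5 : Q x ≤ ‖x‖ * ‖x‖ := by
        simp only [hQ]
        linarith [sq_nonneg (inner ℝ ν x)]
      have h6 : κ * Q x ≤ κ * (‖x‖ * ‖x‖) := by gcongr
      have h7 : ‖x‖ * (2 * κ) * ‖x‖ ≤ c * ‖x‖ := by gcongr; exact hxs.2.le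
      linarith
    have hνx : inner ℝ ν x ≤ ‖x‖ := (le_abs_self _).trans (abs_inner_le_norm_of_norm_one hν x)
    rw [norm_norm, Real.norm_eq_abs, abs_le]
    rcases eq_or_lt_of_le (show 0 ≤ inner ℝ ν x from hx0) with h0 | h0
    · have h5 := abs_le.1 (hbdry x (mem_ball_zero_iff.2 hxs.1) h0.symm)
      rw [← h0] at h5 ⊢
      simp only [hQ, ← h0] at hQx
      have h6 : 0 ≤ c * ‖x‖ := by positivity
      constructor <;> linarith [h5.1, h5.2]
    · have h5 := hx1 h0
      have h6 := hx3 h0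
      have h7 : c / 2 * inner ℝ ν x ≤ c / 2 * ‖x‖ := by gcongr
      simp only [hG, hG', inner_neg_left] at h5 h6
      constructor <;> linarith
  · refine Eq.trans ?_ (EventuallyAbove.liminf_eq_zero h1 h2)
    congr 1
    funext x
    simp only [hG]
    ring
  · refine Eq.trans ?_ (EventuallyAbove.limsup_neg_eq_zero h3 h4)
    congr 1
    funext x
    simp only [hG', inner_neg_left]
    ring

end Slope

theorem statement_12 {n : ℕ} (lam Lam ε : ℝ) (hlam : 0 < lam) (hLam : lam ≤ Lam)
    (hε : ε ∈ Ioo (0 : ℝ) 1) (p' : Euc n) (hp' : ‖p'‖ ≤ Lam)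
    (u : Euc (n + 1) → ℝ)
    (huC : ContinuousOn u (closure (ball 0 1 ∩ {x : Euc (n + 1) | 0 < x (Fin.last n)})))
    (hsup : ViscPucciSuper lam Lam (ball 0 1 ∩ {x | 0 < x (Fin.last n)}) u)
    (hsub : ViscPucciSub lam Lam (ball 0 1 ∩ {x | 0 < x (Fin.last n)}) u)
    (hbdry : ∀ x ∈ ball (0 : Euc (n + 1)) 1, x (Fin.last n) = 0 →
      -(1 / (2 * ε)) * (∑ i : Fin n, (x i.castSucc) ^ 2) + (∑ i : Fin n, p' i * x i.castSucc) ≤ u x ∧ u x ≤ (1 / (2 * ε)) * (∑ i : Fin n, (x i.castSucc) ^ 2) + (∑ i : Fin n, p' i * x i.castSucc)) :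
    u 0 = 0 ∧ ∃ pn : ℝ,
      ((fun x : Euc (n + 1) => u x - ((∑ i : Fin n, p' i * x i.castSucc) + pn * x (Fin.last n)))
        =o[𝓝[{x : Euc (n + 1) | 0 ≤ x (Fin.last n)}] 0] fun x => ‖x‖) ∧
      Filter.liminf (fun x : Euc (n + 1) =>
          (u x - (-(1 / (2 * ε)) * (∑ i : Fin n, (x i.castSucc) ^ 2) + (∑ i : Fin n, p' i * x i.castSucc) + pn * x (Fin.last n))) / x (Fin.last n))
        (𝓝[{x : Euc (n + 1) | 0 < x (Fin.last n)}] 0) = 0 ∧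
      Filter.limsup (fun x : Euc (n + 1) =>
          (u x - ((1 / (2 * ε)) * (∑ i : Fin n, (x i.castSucc) ^ 2) + (∑ i : Fin n, p' i * x i.castSucc) + pn * x (Fin.last n))) / x (Fin.last n))
        (𝓝[{x : Euc (n + 1) | 0 < x (Fin.last n)}] 0) = 0 := by
  have hL : 0 < Lam := hlam.trans_le hLam
  have hκ : 0 < 1 / (2 * ε) := by have := hε.1; positivity
  have hu0 := hbdry 0 (mem_ball_self one_pos) rfl
  refine ⟨le_antisymm (by simpa using hu0.2) (by simpa using hu0.1), ?_⟩
  set ν : Euc (n + 1) := EuclideanSpace.single (Fin.last n) 1 with hνdef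
  set P : Euc (n + 1) := WithLp.toLp 2 (Fin.snoc (p' : Fin n → ℝ) (0 : ℝ)) with hPdef
  have hν : ‖ν‖ = 1 := by simp [hνdef]
  have hνx : ∀ x : Euc (n + 1), x (Fin.last n) = inner ℝ ν x := fun x => by
    simp [hνdef, EuclideanSpace.inner_single_left]
  have hPx : ∀ x : Euc (n + 1), ∑ i : Fin n, p' i * x i.castSucc = inner ℝ P x := fun x => by
    simp [hPdef, PiLp.inner_apply, Fin.sum_univ_castSucc, mul_comm]
  have hQx : ∀ x : Euc (n + 1), ∑ i : Fin n, x i.castSucc ^ 2 = ‖x‖ ^ 2 - inner ℝ ν x ^ 2 :=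
    fun x => by
      rw [EuclideanSpace.norm_sq_eq, ← hνx, Fin.sum_univ_castSucc]
      simp
  simp only [hνx, hPx, hQx] at huC hsup hsub hbdry ⊢
  have hopen : IsOpen (ball (0 : Euc (n + 1)) 1 ∩ {x | 0 < inner ℝ ν x}) :=
    isOpen_ball.inter (isOpen_lt continuous_const (by fun_prop))
  obtain ⟨K₀, hK₀⟩ := (isBounded_ball.subset inter_subset_left).isCompact_closure
    |>.exists_bound_of_continuousOn huC
  have hbound : ∀ x ∈ ball (0 : Euc (n + 1)) 1 ∩ {x | 0 < inner ℝ ν x}, |u x| ≤ max K₀ 0 :=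
    fun x hx => (hK₀ x (subset_closure hx)).trans (le_max_left _ _)
  refine exists_normal_derivative hlam (K := Lam * (n + 1 : ℕ)) (b := Lam)
    (f := Lam * max K₀ 0 + Lam) ?_ hL.le (by positivity) hκ hν huC
    (hsup.jetSuper hlam hLam hopen (le_max_right _ _) hbound)
    (hsub.jetSuper_neg hlam hLam hopen (le_max_right _ _) hbound) fun x hx hx0 => ?_
  · push_cast
    nlinarith [show (0 : ℝ) ≤ n from n.cast_nonneg]
  · have := hbdry x hx hx0
    rw [abs_le]
    constructor <;> linarith
end
end

section
/- Let H ∈ C(ℝⁿ) be such that every sub-level set {p : H(p) ≤ λ} is bounded and {p : H(p) ≤ 0} is nonempty, and let r > 0. If u ∈ C(B_r) is a viscosity sub-solution of H(Du) ≤ 0 in B_r, then u(x) ≤ u(0) + φ⁺(x) for all x ∈ B_r, where φ⁺(x) := max_{p ∈ {H≤0}} p·x. -/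
open Metric Set Filter Topology Bornology

noncomputable section

/-- `φ` is an admissible C² test function touching `u` from above at `x₀` on `ball x₀ r ⊆ Ω`. -/
def SubTest {n : ℕ} (Ω : Set (Euc n)) (u : Euc n → ℝ) (x₀ : Euc n)
    (φ : Euc n → ℝ) (r : ℝ) : Prop :=
  0 < r ∧ ball x₀ r ⊆ Ω ∧ ContDiffOn ℝ 2 φ (ball x₀ r) ∧
    (∀ x ∈ ball x₀ r, u x ≤ φ x) ∧ u x₀ = φ x₀

/-- `φ` is an admissible C² test function touching `u` from below at `x₀` on `ball x₀ r ⊆ Ω`. -/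
def SupTest {n : ℕ} (Ω : Set (Euc n)) (u : Euc n → ℝ) (x₀ : Euc n)
    (φ : Euc n → ℝ) (r : ℝ) : Prop :=
  0 < r ∧ ball x₀ r ⊆ Ω ∧ ContDiffOn ℝ 2 φ (ball x₀ r) ∧
    (∀ x ∈ ball x₀ r, φ x ≤ u x) ∧ u x₀ = φ x₀

lemma inner_gradient_eq_fderiv {n : ℕ} (φ : Euc n → ℝ) (x y : Euc n) :
    inner ℝ (gradient φ x) y = fderiv ℝ φ x y := by
  rw [gradient, InnerProductSpace.toDual_symm_apply]

lemma sum_mul_eq_inner {n : ℕ} (p x : Euc n) : ∑ i, p i * x i = inner ℝ p x := by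
  simp [PiLp.inner_apply, mul_comm]

/-- The squared distance from `x` to the line through `0` and `y`. -/
def perpSq {n : ℕ} (y x : Euc n) : ℝ := ‖x‖ ^ 2 - (inner ℝ y x / ‖y‖ ^ 2) ^ 2 * ‖y‖ ^ 2

lemma perpSq_add_smul {n : ℕ} {y : Euc n} (hy : y ≠ 0) (x : Euc n) (s : ℝ) :
    perpSq y (x + s • y) = perpSq y x := by
  have h : ‖y‖ ≠ 0 := norm_ne_zero_iff.2 hy
  simp only [perpSq, norm_add_sq_real, inner_add_right, inner_smul_right, norm_smul,
    real_inner_self_eq_norm_sq, mul_pow, Real.norm_eq_abs, sq_abs, real_inner_comm]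
  field_simp
  ring

lemma perpSq_nonneg {n : ℕ} {y : Euc n} (hy : y ≠ 0) (x : Euc n) : 0 ≤ perpSq y x := by
  have h : 0 < ‖y‖ := norm_pos_iff.2 hy
  have h1 := real_inner_mul_inner_self_le y x
  simp only [real_inner_self_eq_norm_sq] at h1
  have h2 : (inner ℝ y x / ‖y‖ ^ 2) ^ 2 * ‖y‖ ^ 2 = inner ℝ y x * inner ℝ y x / ‖y‖ ^ 2 := by
    field_simp
  rw [perpSq, h2, sub_nonneg, div_le_iff₀ (by positivity)]
  linarith

/-- If `u` grows from `0` to `y` by more than `m`, then some `C²` function touching `u` from above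
has a gradient `p` with `p · y > m`. -/
lemma exists_subTest_of_lt {n : ℕ} {r : ℝ} {u : Euc n → ℝ} (huC : ContinuousOn u (ball 0 r))
    {y : Euc n} (hy : y ∈ ball (0 : Euc n) r) (hy0 : y ≠ 0) {m : ℝ} (hm : u 0 + m < u y) :
    ∃ x₀ φ ρ, SubTest (ball 0 r) u x₀ φ ρ ∧ m < inner ℝ (gradient φ x₀) y := by
  have hyp : 0 < ‖y‖ := norm_pos_iff.2 hy0
  have hyr : ‖y‖ < r := by simpa using hy
  obtain ⟨ε, hε, hgap⟩ : ∃ ε : ℝ, 0 < ε ∧ u 0 + m + 4 * ε = u y :=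
    ⟨(u y - u 0 - m) / 4, by linarith, by ring⟩
  obtain ⟨T, hT1, hTr⟩ : ∃ T : ℝ, 1 < T ∧ T * ‖y‖ < r :=
    ⟨(‖y‖ + r) / (2 * ‖y‖), by rw [lt_div_iff₀ (by positivity)]; linarith,
      by rw [div_mul_eq_mul_div, div_lt_iff₀ (by positivity)]; nlinarith⟩
  have hT0 : 0 < T := by linarith
  obtain ⟨η, hη, hu0⟩ : ∃ η > 0, ∀ x : Euc n, ‖x‖ < η → u x < u 0 + ε := by
    have hc : ContinuousAt u 0 :=
      huC.continuousAt (isOpen_ball.mem_nhds (mem_ball_self (hyp.trans hyr)))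
    obtain ⟨η, hη, h⟩ := Metric.eventually_nhds_iff.1
      (hc.eventually (gt_mem_nhds (show u 0 < u 0 + ε by linarith)))
    exact ⟨η, hη, fun x hx => h (by simpa using hx)⟩
  obtain ⟨D, hD, hDη, hDr⟩ : ∃ D : ℝ, 0 < D ∧ D < η ^ 2 ∧ T ^ 2 * ‖y‖ ^ 2 + D < r ^ 2 := by
    have h1 : 0 < r ^ 2 - T ^ 2 * ‖y‖ ^ 2 := by
      have : 0 < T * ‖y‖ := by positivity
      nlinarith
    obtain ⟨D, hD, hD'⟩ := exists_between (lt_min (by positivity : 0 < η ^ 2) h1)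
    exact ⟨D, hD, hD'.trans_le (min_le_left _ _),
      by linarith [hD'.trans_le (min_le_right _ _)]⟩
  set t : Euc n → ℝ := fun x => inner ℝ y x / ‖y‖ ^ 2 with ht
  have htC : ContDiff ℝ 2 t := (contDiff_const.inner ℝ contDiff_id).div_const _
  have hqC : ContDiff ℝ 2 (perpSq y) :=
    (contDiff_norm_sq ℝ).sub ((htC.pow 2).mul contDiff_const)
  have hnorm (x : Euc n) : ‖x‖ ^ 2 = t x ^ 2 * ‖y‖ ^ 2 + perpSq y x := by
    simp only [perpSq, ht]; ring
  have htadd (x : Euc n) (s : ℝ) : t (x + s • y) = t x + s := by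
    simp only [ht, inner_add_right, inner_smul_right, real_inner_self_eq_norm_sq]
    field_simp
  have hty : t y = 1 := by
    simp only [ht, real_inner_self_eq_norm_sq]
    field_simp
  have hqy : perpSq y y = 0 := by
    have := hnorm y
    rw [hty] at this
    linarith
  set C : Set (Euc n) := {x | 0 ≤ t x ∧ t x ≤ T ∧ perpSq y x ≤ D} with hC
  have hCr : C ⊆ ball 0 r := by
    rintro x ⟨h0, h1, h2⟩
    rw [mem_ball_zero_iff]
    refine lt_of_pow_lt_pow_left₀ 2 (by linarith) ?_
    have : t x ^ 2 * ‖y‖ ^ 2 ≤ T ^ 2 * ‖y‖ ^ 2 := by gcongr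
    linarith [hnorm x]
  have hCcl : IsClosed C :=
    (isClosed_le continuous_const htC.continuous).inter
      ((isClosed_le htC.continuous continuous_const).inter
        (isClosed_le hqC.continuous continuous_const))
  have hCc : IsCompact C := Metric.isCompact_of_isClosed_isBounded hCcl
    (isBounded_ball.subset hCr)
  have hyC : y ∈ C := ⟨by simp [hty], by simp [hty, hT1.le], by simp [hqy, hD.le]⟩
  have hvC : ContinuousOn (fun x => u x - (m + ε) * t x) C :=
    (huC.mono hCr).sub (continuousOn_const.mul htC.continuous.continuousOn)
  obtain ⟨M, hM⟩ := hCc.exists_bound_of_continuousOn hvC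
  have hMv (x : Euc n) (hx : x ∈ C) :
      -M ≤ u x - (m + ε) * t x ∧ u x - (m + ε) * t x ≤ M := abs_le.1 (hM x hx)
  obtain ⟨N, hN⟩ := pow_unbounded_of_one_lt ((2 * M + ε) / ε) hT1
  rw [div_lt_iff₀ hε] at hN
  obtain ⟨K, hK0, hK⟩ : ∃ K : ℝ, 0 ≤ K ∧ 2 * M + ε < K * D := by
    refine ⟨(|2 * M + ε| + 1) / D, by positivity, ?_⟩
    rw [div_mul_cancel₀ _ hD.ne']
    linarith [le_abs_self (2 * M + ε)]
  set ψ : Euc n → ℝ := fun x => (m + ε) * t x + ε * t x ^ N + K * perpSq y x with hψ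
  have hψC : ContDiff ℝ 2 ψ :=
    ((contDiff_const.mul htC).add (contDiff_const.mul (htC.pow N))).add (contDiff_const.mul hqC)
  obtain ⟨x₀, hx₀, hmax⟩ := hCc.exists_isMaxOn ⟨y, hyC⟩
    ((huC.mono hCr).sub hψC.continuous.continuousOn)
  have hxy : u y - ψ y ≤ u x₀ - ψ x₀ := hmax hyC
  have hψy : ψ y = m + ε + ε := by simp [hψ, hty, hqy]
  obtain ⟨h0, h1, h2⟩ := hx₀
  have hq0 : 0 ≤ K * perpSq y x₀ := mul_nonneg hK0 (perpSq_nonneg hy0 x₀)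
  have hp0 : 0 ≤ ε * t x₀ ^ N := by positivity
  have hMy := hMv y hyC
  have hM0 := hMv x₀ ⟨h0, h1, h2⟩
  rw [hty] at hMy
  rw [hψy] at hxy
  simp only [hψ] at hxy
  have h0' : 0 < t x₀ := by
    refine h0.lt_of_ne fun h => ?_
    have : ‖x₀‖ < η := by
      refine lt_of_pow_lt_pow_left₀ 2 hη.le ?_
      rw [hnorm, ← h]
      linarith
    have := hu0 x₀ this
    have h3 : (m + ε) * t x₀ = 0 := by rw [← h, mul_zero]
    linarith
  have h1' : t x₀ < T := by
    refine h1.lt_of_ne fun h => ?_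
    have : ε * t x₀ ^ N = T ^ N * ε := by rw [h, mul_comm]
    linarith
  have h2' : perpSq y x₀ < D := by
    refine h2.lt_of_ne fun h => ?_
    rw [h] at hxy
    linarith
  have hU : IsOpen {x : Euc n | 0 < t x ∧ t x < T ∧ perpSq y x < D} :=
    (isOpen_lt continuous_const htC.continuous).inter
      ((isOpen_lt htC.continuous continuous_const).inter
        (isOpen_lt hqC.continuous continuous_const))
  obtain ⟨ρ, hρ, hball⟩ := Metric.isOpen_iff.1 hU x₀ ⟨h0', h1', h2'⟩
  have hsub : ball x₀ ρ ⊆ C := fun x hx =>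
    ⟨(hball hx).1.le, (hball hx).2.1.le, (hball hx).2.2.le⟩
  have hφC : ContDiff ℝ 2 (fun x => ψ x + (u x₀ - ψ x₀)) := hψC.add contDiff_const
  refine ⟨x₀, fun x => ψ x + (u x₀ - ψ x₀), ρ, ⟨hρ, hsub.trans hCr, hφC.contDiffOn,
    fun x hx => ?_, by ring⟩, ?_⟩
  · have : u x - ψ x ≤ u x₀ - ψ x₀ := hmax (hsub hx)
    linarith
  have hline := ((hφC.differentiable (by norm_num)) x₀).hasFDerivAt.hasLineDerivAt y
  have hderiv : HasLineDerivAt ℝ (fun x => ψ x + (u x₀ - ψ x₀))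
      ((m + ε) * 1 + ε * (N * (t x₀ + 0) ^ (N - 1) * 1)) x₀ y := by
    have hid : HasDerivAt (fun s : ℝ => t x₀ + s) 1 0 := (hasDerivAt_id 0).const_add _
    have := (((hid.const_mul (m + ε)).add ((hid.pow N).const_mul ε)).add_const
      (K * perpSq y x₀)).add_const (u x₀ - ψ x₀)
    simp only [HasLineDerivAt, hψ, htadd, perpSq_add_smul hy0]
    exact this
  rw [inner_gradient_eq_fderiv, hline.unique hderiv]
  have : 0 ≤ ε * (N * (t x₀ + 0) ^ (N - 1) * 1) := by
    rw [add_zero]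
    positivity
  linarith

theorem statement_13 {n : ℕ} (H : Euc n → ℝ) (hHC : Continuous H)
    (hbdd : ∀ c : ℝ, Bornology.IsBounded {p : Euc n | H p ≤ c})
    (hne : {p : Euc n | H p ≤ 0}.Nonempty)
    (r : ℝ) (hr : 0 < r) (u : Euc n → ℝ) (huC : ContinuousOn u (ball 0 r))
    (husub : ∀ x₀ : Euc n, ∀ φ : Euc n → ℝ, ∀ ρ : ℝ, SubTest (ball 0 r) u x₀ φ ρ →
      H (gradient φ x₀) ≤ 0) :
    ∀ x ∈ ball (0 : Euc n) r,
      u x ≤ u 0 + sSup ((fun p : Euc n => ∑ i, p i * x i) '' {p | H p ≤ 0}) := by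
  intro x hx
  simp only [sum_mul_eq_inner]
  have hle (p : Euc n) (hp : H p ≤ 0) :
      inner ℝ p x ≤ sSup ((fun p : Euc n => inner ℝ p x) '' {p | H p ≤ 0}) := by
    refine le_csSup ?_ ⟨p, hp, rfl⟩
    obtain ⟨R, hR⟩ := (hbdd 0).exists_norm_le
    refine ⟨R * ‖x‖, ?_⟩
    rintro _ ⟨q, hq, rfl⟩
    exact (real_inner_le_norm q x).trans
      (mul_le_mul_of_nonneg_right (hR q hq) (norm_nonneg x))
  by_contra! hlt
  rcases eq_or_ne x 0 with rfl | hx0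
  · obtain ⟨p, hp⟩ := hne
    have := hle p hp
    rw [inner_zero_right] at this
    linarith
  · obtain ⟨x₀, φ, ρ, hφ, hgrad⟩ := exists_subTest_of_lt huC hx hx0 hlt
    exact (hle _ (husub x₀ φ ρ hφ)).not_gt hgrad
end
end

section
/- Let Ω ⊆ ℝⁿ be an open convex set and let H ∈ C(ℝⁿ) be such that every sub-level set {p : H(p) ≤ λ} is bounded and {p : H(p) ≤ 0} is nonempty. If u ∈ C(Ω) is a viscosity sub-solution of H(Du) ≤ 0 in Ω, then for every x₀ ∈ Ω and r > 0 with B_{2r}(x₀) ⊆ Ω and every x, y ∈ B_r(x₀), one has φ⁻(x−y) ≤ u(x) − u(y) ≤ φ⁺(x−y), where φ⁺(x) := max_{p∈{H≤0}} p·x and φ⁻(x) := −max_{p∈{H≤0}} (−p·x). -/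
open Metric Set Filter Topology Bornology

noncomputable section

/-- If the directional derivative of every test function along `x - y` is at most `σ` at touching
points, then `u x - u y ≤ σ`. -/
theorem sub_le_of_subTest_inner_le {n : ℕ} {Ω : Set (Euc n)} {u : Euc n → ℝ}
    (huC : ContinuousOn u Ω) {x₀ x y : Euc n} {r σ : ℝ} (hΩ : closedBall x₀ r ⊆ Ω)
    (hx : x ∈ ball x₀ r) (hy : y ∈ ball x₀ r) (hxy : x ≠ y)
    (hσ : ∀ z φ ρ, SubTest Ω u z φ ρ → inner ℝ (gradient φ z) (x - y) ≤ σ) :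
    u x - u y ≤ σ := by
  by_contra! hlt
  obtain ⟨e, he⟩ : ∃ e, e = x - y := ⟨_, rfl⟩
  have he0 : e ≠ 0 := he ▸ sub_ne_zero.2 hxy
  have hee : inner ℝ e e ≠ (0 : ℝ) := inner_self_ne_zero.2 he0
  have hsub : ball x₀ r ⊆ closedBall x₀ r := ball_subset_closedBall
  have hyx : y + (1 : ℝ) • e = x := by simp [he]
  -- a slight prolongation of the segment from `y` to `x`
  obtain ⟨T, hT1, hTball⟩ : ∃ T : ℝ, 1 < T ∧ y + T • e ∈ ball x₀ r := by
    have hc : Continuous fun t : ℝ => y + t • e := by fun_prop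
    have hn : ∀ᶠ t in 𝓝 (1 : ℝ), y + t • e ∈ ball x₀ r :=
      hc.continuousAt.eventually_mem (isOpen_ball.mem_nhds (hyx ▸ hx))
    obtain ⟨ε, hε, h⟩ := Metric.eventually_nhds_iff.1 hn
    refine ⟨1 + ε / 2, by linarith, h ?_⟩
    rw [Real.dist_eq, add_sub_cancel_left, abs_of_pos (by positivity)]
    linarith
  obtain ⟨r', hr', hseg⟩ : ∃ r' < r, ∀ t ∈ Icc 0 T, y + t • e ∈ closedBall x₀ r' := by
    refine ⟨max (dist y x₀) (dist (y + T • e) x₀), max_lt hy hTball, fun t ht => ?_⟩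
    have hT0 : 0 < T := by linarith
    refine (convex_closedBall x₀ _).segment_subset (x := y) (y := y + T • e)
      (mem_closedBall.2 (le_max_left _ _)) (mem_closedBall.2 (le_max_right _ _)) ?_
    rw [segment_eq_image']
    exact ⟨t / T, ⟨div_nonneg ht.1 hT0.le, (div_le_one hT0).2 ht.2⟩, by
      simp [smul_smul, div_mul_cancel₀ _ hT0.ne']⟩
  obtain ⟨M, hM⟩ : ∃ M, ∀ z ∈ closedBall x₀ r, u z ≤ M := by
    obtain ⟨M, hM⟩ := (isCompact_closedBall x₀ r).bddAbove_image (huC.mono hΩ)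
    exact ⟨M, fun z hz => hM (mem_image_of_mem _ hz)⟩
  obtain ⟨d, hd⟩ : ∃ d, d = u x - u y - σ := ⟨_, rfl⟩
  have hd0 : 0 < d := by linarith
  obtain ⟨ρ, hρ, hρr, hρu⟩ : ∃ ρ > 0, r' + ρ ≤ r ∧ ∀ z, dist z y < ρ → u z < u y + d / 2 := by
    have hca : ContinuousAt u y :=
      huC.continuousAt (mem_of_superset (isOpen_ball.mem_nhds hy) (hsub.trans hΩ))
    have hn : ∀ᶠ z in 𝓝 y, u z < u y + d / 2 := hca.eventually_lt_const (by linarith)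
    obtain ⟨ε, hε, h⟩ := Metric.eventually_nhds_iff.1 hn
    exact ⟨min ε (r - r'), lt_min hε (by linarith), by linarith [min_le_right ε (r - r')],
      fun z hz => h (hz.trans_le (min_le_left _ _))⟩
  obtain ⟨s, hs⟩ : ∃ s, s = σ + d / 4 := ⟨_, rfl⟩
  obtain ⟨N, hN⟩ : ∃ N : ℕ, M - s * T - d / 4 * T ^ (N + 1) < u y + d / 2 := by
    obtain ⟨N, hN⟩ := pow_unbounded_of_one_lt ((M - s * T - u y) / (d / 4)) hT1
    refine ⟨N, ?_⟩
    have h1 := hN.trans_le (pow_le_pow_right₀ hT1.le N.le_succ)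
    rw [div_lt_iff₀ (by positivity)] at h1
    simp only [Nat.succ_eq_add_one] at h1
    linarith
  obtain ⟨K, hK0, hK⟩ : ∃ K : ℝ, 0 ≤ K ∧ M + |s| * T < u y + d / 2 + K * ρ ^ 2 := by
    refine ⟨|M + |s| * T - u y| / ρ ^ 2, by positivity, ?_⟩
    rw [div_mul_cancel₀ _ (by positivity)]
    linarith [le_abs_self (M + |s| * T - u y)]
  -- the coordinate along `e` and the transversal component
  obtain ⟨l, hl⟩ : ∃ l : Euc n → ℝ, l = fun z => inner ℝ e (z - y) / inner ℝ e e := ⟨_, rfl⟩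
  obtain ⟨w, hw⟩ : ∃ w : Euc n → Euc n, w = fun z => z - y - l z • e := ⟨_, rfl⟩
  have hlC : ContDiff ℝ 2 l :=
    hl ▸ (contDiff_const.inner ℝ (contDiff_id.sub contDiff_const)).div_const _
  have hwC : ContDiff ℝ 2 w := by rw [hw]; fun_prop
  have hl_add : ∀ z (t : ℝ), l (z + t • e) = l z + t := by
    intro z t
    simp only [hl]
    rw [add_sub_right_comm, inner_add_right, inner_smul_right]
    field_simp
  have hw_add : ∀ z (t : ℝ), w (z + t • e) = w z := by
    intro z t
    simp only [hw, hl_add]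
    module
  have hly : l y = 0 := by simp [hl]
  have hwy : w y = 0 := by simp [hw, hly]
  have hlx : l x = 1 := by rw [← hyx, hl_add, hly, zero_add]
  have hwx : w x = 0 := by rw [← hyx, hw_add, hwy]
  obtain ⟨φ, hφ⟩ : ∃ φ : Euc n → ℝ,
    φ = fun z => s * l z + d / 4 * l z ^ (N + 1) + K * ‖w z‖ ^ 2 := ⟨_, rfl⟩
  have hφC : ContDiff ℝ 2 φ := by
    have := hwC.norm_sq ℝ
    rw [hφ]; fun_prop
  have hCcomp : IsCompact (closedBall x₀ r ∩ l ⁻¹' Icc 0 T) :=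
    (isCompact_closedBall x₀ r).inter_right (isClosed_Icc.preimage hlC.continuous)
  have hxC : x ∈ closedBall x₀ r ∩ l ⁻¹' Icc 0 T :=
    ⟨hsub hx, by simp only [mem_preimage, hlx]; constructor <;> linarith⟩
  obtain ⟨z, ⟨hzb, hzl0, hzlT⟩, hzmax⟩ := hCcomp.exists_isMaxOn ⟨x, hxC⟩
    (f := fun z => u z - φ z)
    ((huC.mono (inter_subset_left.trans hΩ)).sub hφC.continuous.continuousOn)
  have hzx : u y + d / 2 ≤ u z - φ z := by
    have h1 : u x - φ x ≤ u z - φ z := hzmax hxC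
    have h2 : φ x = s + d / 4 := by simp [hφ, hlx, hwx]
    linarith
  have hφz : φ z = s * l z + d / 4 * l z ^ (N + 1) + K * ‖w z‖ ^ 2 := by rw [hφ]
  have hpow : 0 ≤ d / 4 * l z ^ (N + 1) := by positivity
  have hKw : 0 ≤ K * ‖w z‖ ^ 2 := by positivity
  have huzM := hM z hzb
  have hwz : ‖w z‖ < ρ := by
    by_contra! h
    have h1 : K * ρ ^ 2 ≤ K * ‖w z‖ ^ 2 := by gcongr
    have h2 : -(|s| * T) ≤ s * l z := by
      have h3 : |s| * l z ≤ |s| * T := by gcongr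
      have h4 : -|s| * l z ≤ s * l z := by
        gcongr
        exact neg_abs_le s
      linarith
    linarith
  have hl_pos : 0 < l z := by
    refine hzl0.lt_of_ne fun h => ?_
    have h1 : dist z y < ρ := by
      have h2 : z - y = w z := by simp [hw, ← h]
      rwa [dist_eq_norm, h2]
    have h2 := hρu z h1
    rw [← h] at hφz hpow
    linarith
  have hl_lt : l z < T := by
    refine hzlT.lt_of_ne fun h => ?_
    rw [h] at hφz
    linarith
  have hzball : z ∈ ball x₀ r := by
    have h1 := mem_closedBall.1 (hseg (l z) ⟨hzl0, hzlT⟩)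
    have h2 : dist z (y + l z • e) < ρ := by
      have h3 : z - (y + l z • e) = w z := by simp only [hw]; abel
      rwa [dist_eq_norm, h3]
    rw [mem_ball]
    linarith [dist_triangle z (y + l z • e) x₀]
  have hopen : IsOpen (ball x₀ r ∩ l ⁻¹' Ioo 0 T) :=
    isOpen_ball.inter (isOpen_Ioo.preimage hlC.continuous)
  obtain ⟨ε, hε, hεsub⟩ := Metric.isOpen_iff.1 hopen z ⟨hzball, hl_pos, hl_lt⟩
  have htest : SubTest Ω u z (fun v => φ v + (u z - φ z)) ε := by
    refine ⟨hε, fun v hv => hΩ (hsub (hεsub hv).1), (hφC.add contDiff_const).contDiffOn,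
      fun v hv => ?_, by ring⟩
    have h1 : u v - φ v ≤ u z - φ z :=
      hzmax ⟨hsub (hεsub hv).1, Ioo_subset_Icc_self (hεsub hv).2⟩
    linarith
  have hle := hσ _ _ _ htest
  have hdiff : DifferentiableAt ℝ (fun v => φ v + (u z - φ z)) z :=
    (hφC.differentiable (by norm_num) z).add_const _
  have hline := hdiff.hasFDerivAt.hasLineDerivAt e
  have hline' : HasLineDerivAt ℝ (fun v => φ v + (u z - φ z))
      (s + d / 4 * ((N + 1 : ℕ) * l z ^ N)) z e := by
    unfold HasLineDerivAt
    simp only [hφ, hl_add, hw_add]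
    have h0 : HasDerivAt (fun t : ℝ => l z + t) 1 0 := (hasDerivAt_id (0 : ℝ)).const_add _
    have h := (((h0.const_mul s).add ((h0.pow (N + 1)).const_mul (d / 4))).add_const
      (K * ‖w z‖ ^ 2)).add_const (u z - (s * l z + d / 4 * l z ^ (N + 1) + K * ‖w z‖ ^ 2))
    convert h using 1
    · rfl
    · simp only [add_zero, mul_one, add_tsub_cancel_right]
  rw [← he, gradient, InnerProductSpace.toDual_symm_apply, hline.unique hline'] at hle
  have : 0 ≤ d / 4 * ((N + 1 : ℕ) * l z ^ N) := by positivity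
  linarith

theorem inner_eq_sum_mul {n : ℕ} (p e : Euc n) : inner ℝ p e = ∑ i, p i * e i := by
  simp [PiLp.inner_apply, mul_comm]

/-- The pairing with a fixed vector is bounded above on a bounded set. -/
theorem bddAbove_image_sum_mul {n : ℕ} {S : Set (Euc n)} (hS : IsBounded S) (e : Euc n) :
    BddAbove ((fun p : Euc n => ∑ i, p i * e i) '' S) := by
  obtain ⟨C, hC⟩ := hS.exists_norm_le
  refine ⟨C * ‖e‖, ?_⟩
  rintro _ ⟨p, hp, rfl⟩
  calc ∑ i, p i * e i = inner ℝ p e := (inner_eq_sum_mul p e).symm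
    _ ≤ ‖p‖ * ‖e‖ := real_inner_le_norm p e
    _ ≤ C * ‖e‖ := by gcongr; exact hC p hp

theorem statement_14 {n : ℕ} (H : Euc n → ℝ) (hHC : Continuous H)
    (hbdd : ∀ c : ℝ, Bornology.IsBounded {p : Euc n | H p ≤ c})
    (hne : {p : Euc n | H p ≤ 0}.Nonempty)
    (Ω : Set (Euc n)) (hΩ : IsOpen Ω) (hconv : Convex ℝ Ω)
    (u : Euc n → ℝ) (huC : ContinuousOn u Ω)
    (husub : ∀ x₀ : Euc n, ∀ φ : Euc n → ℝ, ∀ ρ : ℝ, SubTest Ω u x₀ φ ρ →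
      H (gradient φ x₀) ≤ 0) :
    ∀ x₀ ∈ Ω, ∀ r : ℝ, 0 < r → ball x₀ (2 * r) ⊆ Ω →
      ∀ x ∈ ball x₀ r, ∀ y ∈ ball x₀ r,
        -sSup ((fun p : Euc n => ∑ i, p i * (y i - x i)) '' {p | H p ≤ 0}) ≤ u x - u y ∧
        u x - u y ≤ sSup ((fun p : Euc n => ∑ i, p i * (x i - y i)) '' {p | H p ≤ 0}) := by
  intro x₀ _ r hr hball
  have hcb : closedBall x₀ r ⊆ Ω := (closedBall_subset_ball (by linarith)).trans hball
  have key : ∀ x ∈ ball x₀ r, ∀ y ∈ ball x₀ r,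
      u x - u y ≤ sSup ((fun p : Euc n => ∑ i, p i * (x i - y i)) '' {p | H p ≤ 0}) := by
    intro x hx y hy
    rcases eq_or_ne x y with rfl | hxy
    · simp [hne.image_const]
    refine sub_le_of_subTest_inner_le huC hcb hx hy hxy fun z φ ρ h => ?_
    refine le_csSup (bddAbove_image_sum_mul (hbdd 0) (x - y)) ⟨_, husub z φ ρ h, ?_⟩
    exact (inner_eq_sum_mul (gradient φ z) (x - y)).symm
  exact fun x hx y hy => ⟨by linarith [key y hy x hx], key x hx y hy⟩
end
end
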